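/- For every ε > 0, the probability that W̄ > Φ(λ) + ε is o(1/N²) as n → ∞, where W̄ := Σ_{(u,v)∈H_x×H_y} w(u)w(v)·1{w(u)w(v) > θ} is the large-weight part of the pair-weight sum produced by the exposure process. -/

import Mathlib

open Classical Filter Finset

noncomputable section

/-- The set of half-edges: `deg v` half-edges attached to each vertex `v`. -/
abbrev HE (k : ℕ) (dg : Fin k → ℕ) : Type := (v : Fin k) × Fin (dg v)

/-- A pairing is a fixed-point-free involution of the half-edges. -/
def IsPairing {k : ℕ} {dg : Fin k → ℕ} (π : Equiv.Perm (HE k dg)) : Prop :=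
  (∀ x, π (π x) = x) ∧ ∀ x, π x ≠ x

/-- `N`, the total number of half-edges. -/
def Nh {k : ℕ} (dg : Fin k → ℕ) : ℕ := ∑ v, dg v

/-- The non-backtracking random walk transition matrix: from `x`, move to a uniformly
chosen neighbour of `π x` (a half-edge at the same vertex as `π x`, distinct from it). -/
def nbrwP {k : ℕ} (dg : Fin k → ℕ) (π : Equiv.Perm (HE k dg)) :
    Matrix (HE k dg) (HE k dg) ℝ := fun x y =>
  if (π x).1 = y.1 ∧ π x ≠ y then ((dg (π x).1 : ℝ) - 1)⁻¹ else 0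

/-- Total-variation distance to the uniform distribution at time `t`, from state `x`. -/
def Dx {k : ℕ} (dg : Fin k → ℕ) (π : Equiv.Perm (HE k dg)) (x : HE k dg) (t : ℕ) : ℝ :=
  (1 / 2) * ∑ y, |((nbrwP dg π) ^ t) x y - (Nh dg : ℝ)⁻¹|

/-- Worst-case total-variation distance to equilibrium at time `t`. -/
def Dmax {k : ℕ} (dg : Fin k → ℕ) (π : Equiv.Perm (HE k dg)) (t : ℕ) : ℝ :=
  ⨆ x, Dx dg π x t

/-- Mixing time. -/
def tmixT {k : ℕ} (dg : Fin k → ℕ) (π : Equiv.Perm (HE k dg)) (ε : ℝ) : ℕ :=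
  sInf {t : ℕ | Dmax dg π t < ε}

/-- The finite set of all pairings of the half-edges. -/
def PairingsF {k : ℕ} (dg : Fin k → ℕ) : Finset (Equiv.Perm (HE k dg)) :=
  univ.filter IsPairing

/-- Probability of an event under the uniformly random pairing. -/
def prP {k : ℕ} (dg : Fin k → ℕ) (Q : Equiv.Perm (HE k dg) → Prop) : ℝ :=
  (((PairingsF dg).filter Q).card : ℝ) / ((PairingsF dg).card : ℝ)

/-- Mean logarithmic degree `μ` of a uniform half-edge. -/
def muD {k : ℕ} (dg : Fin k → ℕ) : ℝ :=
  (Nh dg : ℝ)⁻¹ * ∑ v, (dg v : ℝ) * Real.log ((dg v : ℝ) - 1)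

/-- Variance `σ²` of the logarithmic degree of a uniform half-edge. -/
def sigsq {k : ℕ} (dg : Fin k → ℕ) : ℝ :=
  (Nh dg : ℝ)⁻¹ * ∑ v, (dg v : ℝ) * (Real.log ((dg v : ℝ) - 1) - muD dg) ^ 2

/-- Third absolute central moment `ϱ`. -/
def rhoD {k : ℕ} (dg : Fin k → ℕ) : ℝ :=
  (Nh dg : ℝ)⁻¹ * ∑ v, (dg v : ℝ) * |Real.log ((dg v : ℝ) - 1) - muD dg| ^ 3

/-- Maximum degree `Δ`. -/
def DeltaD {k : ℕ} (dg : Fin k → ℕ) : ℕ := univ.sup dg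

/-- The standard normal tail function `Φ`. -/
def Phi (lam : ℝ) : ℝ :=
  (Real.sqrt (2 * Real.pi))⁻¹ * ∫ u in Set.Ioi lam, Real.exp (-u ^ 2 / 2)

/-- Cutoff time `t⋆ = log N / μ`. -/
def tstar {k : ℕ} (dg : Fin k → ℕ) : ℝ := Real.log (Nh dg) / muD dg

/-- Cutoff window `ω⋆ = √(σ² log N / μ³)`. -/
def wstar {k : ℕ} (dg : Fin k → ℕ) : ℝ :=
  Real.sqrt (sigsq dg * Real.log (Nh dg) / (muD dg) ^ 3)

/-- State of the exposure (exploration) process: the forest `F` (with height, weight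
and root data for each of its half-edges) and the set of already-paired half-edges. -/
structure ExpState (k : ℕ) (dg : Fin k → ℕ) where
  F : Finset (HE k dg)
  paired : Finset (HE k dg)
  ht : HE k dg → ℕ
  wt : HE k dg → ℝ
  rt : HE k dg → HE k dg

/-- Lexicographic encoding of half-edges (vertex index first, then half-edge index),
used for tie-breaking. -/
def enc {k : ℕ} (dg : Fin k → ℕ) (z : HE k dg) : ℕ := z.1.val * (Nh dg + 1) + z.2.val

/-- Candidate half-edges for selection: unpaired members of the forest with height
`< tH` and weight `> wmin`. -/
def cands {k : ℕ} {dg : Fin k → ℕ} (tH : ℕ) (wmin : ℝ) (s : ExpState k dg) :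
    Finset (HE k dg) :=
  s.F.filter fun z => z ∉ s.paired ∧ s.ht z < tH ∧ wmin < s.wt z

/-- `z` is the selected half-edge: a candidate of maximal weight, ties broken by the
lexicographic order on half-edges. -/
def IsSelected {k : ℕ} {dg : Fin k → ℕ} (tH : ℕ) (wmin : ℝ) (s : ExpState k dg)
    (z : HE k dg) : Prop :=
  z ∈ cands tH wmin s ∧ (∀ y ∈ cands tH wmin s, s.wt y ≤ s.wt z) ∧
    ∀ y ∈ cands tH wmin s, s.wt y = s.wt z → enc dg z ≤ enc dg y

/-- One step of the exploration stage: select `z`, reveal its partner `z' = π z`, and,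
if neither `z'` nor any of its neighbours was already in the forest, attach all
neighbours of `z'` as children of `z`. -/
def expStep {k : ℕ} {dg : Fin k → ℕ} (π : Equiv.Perm (HE k dg)) (tH : ℕ) (wmin : ℝ)
    (s : ExpState k dg) : ExpState k dg :=
  if hz : ∃ z, IsSelected tH wmin s z then
    let z := Classical.choose hz
    let z' := π z
    if ∀ y ∈ s.F, y.1 ≠ z'.1 then
      { F := s.F ∪ univ.filter (fun w => w.1 = z'.1 ∧ w ≠ z'),
        paired := insert z (insert z' s.paired),
        ht := fun w => if w.1 = z'.1 ∧ w ≠ z' then s.ht z + 1 else s.ht w,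
        wt := fun w => if w.1 = z'.1 ∧ w ≠ z' then s.wt z * ((dg z'.1 : ℝ) - 1)⁻¹ else s.wt w,
        rt := fun w => if w.1 = z'.1 ∧ w ≠ z' then s.rt z else s.rt w }
    else { s with paired := insert z (insert z' s.paired) }
  else s

/-- Initial state of the exposure process: forest reduced to the two roots `x`, `y`. -/
def expInit {k : ℕ} (dg : Fin k → ℕ) (x y : HE k dg) : ExpState k dg :=
  { F := {x, y}, paired := ∅, ht := fun _ => 0, wt := fun _ => 1,
    rt := fun z => if z = y then y else x }

/-- Final state of the exploration stage (the step map is iterated until it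
stabilizes, which happens within `N` iterations). -/
def expFinal {k : ℕ} (dg : Fin k → ℕ) (π : Equiv.Perm (HE k dg)) (tH : ℕ) (wmin : ℝ)
    (x y : HE k dg) : ExpState k dg :=
  (expStep π tH wmin)^[Nh dg] (expInit dg x y)

/-- `H_r`: unpaired half-edges of the forest with height `tH` and root `r`. -/
def Hset {k : ℕ} {dg : Fin k → ℕ} (s : ExpState k dg) (tH : ℕ) (r : HE k dg) :
    Finset (HE k dg) :=
  s.F.filter fun z => z ∉ s.paired ∧ s.ht z = tH ∧ s.rt z = r

/-- `U`: the set of unpaired half-edges of the forest. -/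
def Uset {k : ℕ} {dg : Fin k → ℕ} (s : ExpState k dg) : Finset (HE k dg) :=
  s.F.filter fun z => z ∉ s.paired

/-- `𝔚`: the small-weight part of the pair-weight sum. -/
def Wle {k : ℕ} {dg : Fin k → ℕ} (s : ExpState k dg) (tH : ℕ) (x y : HE k dg)
    (θ : ℝ) : ℝ :=
  ∑ u ∈ Hset s tH x, ∑ v ∈ Hset s tH y,
    if s.wt u * s.wt v ≤ θ then s.wt u * s.wt v else 0

/-- `𝔚̄`: the large-weight part of the pair-weight sum. -/
def Wgt {k : ℕ} {dg : Fin k → ℕ} (s : ExpState k dg) (tH : ℕ) (x y : HE k dg)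
    (θ : ℝ) : ℝ :=
  ∑ u ∈ Hset s tH x, ∑ v ∈ Hset s tH y,
    if θ < s.wt u * s.wt v then s.wt u * s.wt v else 0

/-- The truncation threshold `w_min = N^{-2/3}`. -/
def wminD {k : ℕ} (dg : Fin k → ℕ) : ℝ := (Nh dg : ℝ) ^ (-(2 : ℝ) / 3)

/-- The weight threshold `θ = 1/(N (log N)²)`. -/
def thetaD {k : ℕ} (dg : Fin k → ℕ) : ℝ :=
  ((Nh dg : ℝ) * (Real.log (Nh dg)) ^ 2)⁻¹

/-- An exploration state together with an auxiliary weight `wh`, which only records the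
steps of a path performed beyond a given height. -/
structure GState (k : ℕ) (dg : Fin k → ℕ) where
  base : ExpState k dg
  wh : HE k dg → ℝ

/-- The exploration state obtained by revealing that the partner of `z` is `a`. -/
def reveal {k : ℕ} {dg : Fin k → ℕ} (s : ExpState k dg) (z a : HE k dg) : ExpState k dg :=
  if ∀ y ∈ s.F, y.1 ≠ a.1 then
    { F := s.F ∪ univ.filter (fun w => w.1 = a.1 ∧ w ≠ a),
      paired := insert z (insert a s.paired),
      ht := fun w => if w.1 = a.1 ∧ w ≠ a then s.ht z + 1 else s.ht w,
      wt := fun w => if w.1 = a.1 ∧ w ≠ a then s.wt z * ((dg a.1 : ℝ) - 1)⁻¹ else s.wt w,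
      rt := fun w => if w.1 = a.1 ∧ w ≠ a then s.rt z else s.rt w }
  else { s with paired := insert z (insert a s.paired) }

/-- The extended version of `reveal`. -/
def gReveal {k : ℕ} {dg : Fin k → ℕ} (h0 : ℕ) (s : GState k dg) (z a : HE k dg) :
    GState k dg where
  base := reveal s.base z a
  wh := fun w =>
    if (∀ y ∈ s.base.F, y.1 ≠ a.1) ∧ w.1 = a.1 ∧ w ≠ a then
      (if s.base.ht z < h0 then s.wh z else s.wh z * ((dg a.1 : ℝ) - 1)⁻¹)
    else s.wh w

/-- One step of the exploration, on extended states. -/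
def gStep {k : ℕ} {dg : Fin k → ℕ} (h0 : ℕ) (π : Equiv.Perm (HE k dg)) (tH : ℕ) (wmin : ℝ)
    (s : GState k dg) : GState k dg :=
  if hz : ∃ z, IsSelected tH wmin s.base z then
    gReveal h0 s (Classical.choose hz) (π (Classical.choose hz))
  else s

/-- The extended state after `j` steps of the exploration. -/
def gRun {k : ℕ} (dg : Fin k → ℕ) (h0 : ℕ) (tH : ℕ) (wmin : ℝ) (x y : HE k dg)
    (π : Equiv.Perm (HE k dg)) (j : ℕ) : GState k dg :=
  (gStep h0 π tH wmin)^[j] ⟨expInit dg x y, fun _ => 1⟩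

section Run

variable {k : ℕ} {dg : Fin k → ℕ} {h0 tH : ℕ} {wmin : ℝ} {x y : HE k dg}

lemma gRun_succ (π : Equiv.Perm (HE k dg)) (j : ℕ) :
    gRun dg h0 tH wmin x y π (j + 1) = gStep h0 π tH wmin (gRun dg h0 tH wmin x y π j) := by
  simp only [gRun, Function.iterate_succ_apply']

lemma gStep_base (π : Equiv.Perm (HE k dg)) (s : GState k dg) :
    (gStep h0 π tH wmin s).base = expStep π tH wmin s.base := by
  unfold gStep expStep
  split_ifs with h
  · simp only [gReveal, reveal]
  · rfl

lemma gRun_base (π : Equiv.Perm (HE k dg)) (j : ℕ) :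
    (gRun dg h0 tH wmin x y π j).base = (expStep π tH wmin)^[j] (expInit dg x y) := by
  induction j with
  | zero => rfl
  | succ j ih => rw [gRun_succ, gStep_base, ih, Function.iterate_succ_apply']

lemma gReveal_paired (s : GState k dg) (z a : HE k dg) :
    (gReveal h0 s z a).base.paired = insert z (insert a s.base.paired) := by
  simp only [gReveal, reveal]
  split_ifs <;> rfl

lemma gRun_paired_closed {π : Equiv.Perm (HE k dg)} (hπ : IsPairing π) (j : ℕ) :
    ∀ a ∈ (gRun dg h0 tH wmin x y π j).base.paired,
      π a ∈ (gRun dg h0 tH wmin x y π j).base.paired := by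
  induction j with
  | zero => intro a ha; simp [gRun, expInit] at ha
  | succ j ih =>
    rw [gRun_succ]
    unfold gStep
    split_ifs with hz
    · rw [gReveal_paired]
      intro a ha
      simp only [mem_insert] at ha ⊢
      rcases ha with rfl | rfl | ha
      · simp
      · left; rw [hπ.1]
      · right; right; exact ih a ha
    · exact ih

/-- The conjugate of a permutation by the transposition of `a` and `b`. -/
def conjSwap (a b : HE k dg) (π : Equiv.Perm (HE k dg)) : Equiv.Perm (HE k dg) :=
  Equiv.swap a b * π * Equiv.swap a b

lemma conjSwap_apply (a b : HE k dg) (π : Equiv.Perm (HE k dg)) (u : HE k dg) :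
    conjSwap a b π u = Equiv.swap a b (π (Equiv.swap a b u)) := rfl

lemma conjSwap_conjSwap (a b : HE k dg) (π : Equiv.Perm (HE k dg)) :
    conjSwap a b (conjSwap a b π) = π := by
  ext1 u; simp [conjSwap_apply]

lemma IsPairing.conjSwap {π : Equiv.Perm (HE k dg)} (hπ : IsPairing π) (a b : HE k dg) :
    IsPairing (conjSwap a b π) := by
  refine ⟨fun u => ?_, fun u h => ?_⟩
  · simp [conjSwap_apply, hπ.1]
  · rw [conjSwap_apply, Equiv.swap_apply_eq_iff] at h
    exact hπ.2 _ h

lemma gRun_conjSwap (π : Equiv.Perm (HE k dg)) (a b : HE k dg) (j : ℕ)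
    (ha : a ∉ (gRun dg h0 tH wmin x y π j).base.paired)
    (hb : b ∉ (gRun dg h0 tH wmin x y π j).base.paired) :
    gRun dg h0 tH wmin x y (conjSwap a b π) j = gRun dg h0 tH wmin x y π j := by
  induction j with
  | zero => rfl
  | succ j ih =>
    rw [gRun_succ] at ha hb
    rw [gRun_succ, gRun_succ]
    unfold gStep at ha hb
    split_ifs at ha hb with hz
    · rw [gReveal_paired] at ha hb
      simp only [mem_insert, not_or] at ha hb
      rw [ih ha.2.2 hb.2.2]
      unfold gStep
      rw [dif_pos hz, dif_pos hz, conjSwap_apply, Equiv.swap_apply_of_ne_of_ne (Ne.symm ha.1)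
        (Ne.symm hb.1), Equiv.swap_apply_of_ne_of_ne (Ne.symm ha.2.1) (Ne.symm hb.2.1)]
    · rw [ih ha hb]
      unfold gStep
      rw [dif_neg hz, dif_neg hz]

/-- The half-edges which may be the partner of `z`. -/
def avail (s : GState k dg) (z : HE k dg) : Finset (HE k dg) :=
  univ.filter fun a => a ∉ s.base.paired ∧ a ≠ z

/-- Conditionally on the current state, the partner of the selected half-edge is uniform. -/
lemma sum_apply_of_gRun_eq (j : ℕ) (s : GState k dg) (z : HE k dg) (hz : z ∉ s.base.paired)
    (g : HE k dg → ℝ) :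
    ((avail s z).card : ℝ) *
      ∑ π ∈ (PairingsF dg).filter (fun π => gRun dg h0 tH wmin x y π j = s), g (π z) =
    (((PairingsF dg).filter (fun π => gRun dg h0 tH wmin x y π j = s)).card : ℝ) *
      ∑ a ∈ avail s z, g a := by
  set S := (PairingsF dg).filter (fun π => gRun dg h0 tH wmin x y π j = s) with hS
  have hmaps : ∀ π ∈ S, π z ∈ avail s z := by
    intro π hπ
    simp only [hS, mem_filter, PairingsF, mem_univ, true_and] at hπ
    simp only [avail, mem_filter, mem_univ, true_and]
    refine ⟨fun h => hz ?_, hπ.1.2 z⟩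
    have := gRun_paired_closed (h0 := h0) (tH := tH) (wmin := wmin) (x := x) (y := y) hπ.1 j (π z)
    rw [hπ.2, hπ.1.1] at this
    exact this h
  have hle : ∀ a ∈ avail s z, ∀ b ∈ avail s z,
      (S.filter (fun π => π z = a)).card ≤ (S.filter (fun π => π z = b)).card := by
    intro a ha b hb
    simp only [avail, mem_filter, mem_univ, true_and] at ha hb
    refine Finset.card_le_card_of_injOn (conjSwap a b) ?_ ?_
    · intro π hπ
      simp only [hS, coe_filter, mem_filter, PairingsF, mem_univ, true_and,
        Set.mem_ofPred_eq] at hπ ⊢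
      refine ⟨⟨hπ.1.1.conjSwap a b, ?_⟩, ?_⟩
      · rw [gRun_conjSwap, hπ.1.2]
        · rw [hπ.1.2]; exact ha.1
        · rw [hπ.1.2]; exact hb.1
      · rw [conjSwap_apply, Equiv.swap_apply_of_ne_of_ne (Ne.symm ha.2) (Ne.symm hb.2), hπ.2,
          Equiv.swap_apply_left]
    · intro π _ π' _ h
      rw [← conjSwap_conjSwap a b π, h, conjSwap_conjSwap]
  have hsum : ∑ π ∈ S, g (π z) =
      ∑ a ∈ avail s z, ((S.filter (fun π => π z = a)).card : ℝ) * g a := by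
    rw [← Finset.sum_fiberwise_of_maps_to hmaps]
    refine Finset.sum_congr rfl fun a _ => ?_
    rw [Finset.sum_congr rfl (g := fun _ => g a), Finset.sum_const, nsmul_eq_mul]
    intro π hπ
    rw [(mem_filter.1 hπ).2]
  have hcard : (S.card : ℝ) = ∑ a ∈ avail s z, ((S.filter (fun π => π z = a)).card : ℝ) := by
    rw [Finset.card_eq_sum_card_fiberwise hmaps]
    push_cast; rfl
  rw [hsum, hcard]
  have hconst : ∀ a ∈ avail s z, ((avail s z).card : ℝ) * (S.filter (fun π => π z = a)).card =
      ∑ b ∈ avail s z, ((S.filter (fun π => π z = b)).card : ℝ) := by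
    intro a ha
    rw [Finset.sum_congr rfl (g := fun _ => ((S.filter (fun π => π z = a)).card : ℝ)),
      Finset.sum_const, nsmul_eq_mul]
    intro b hb
    exact_mod_cast le_antisymm (hle b hb a ha) (hle a ha b hb)
  rw [Finset.mul_sum, Finset.mul_sum]
  refine Finset.sum_congr rfl fun a ha => ?_
  rw [← mul_assoc, hconst a ha]

/-- A function of the state whose average over the possible partners of a selected half-edge
never increases is a supermartingale along the exploration. -/
lemma sum_gRun_succ_le (Ψ : GState k dg → ℝ) (j : ℕ)
    (hΨ : ∀ π ∈ PairingsF dg, ∀ z, z ∈ cands tH wmin (gRun dg h0 tH wmin x y π j).base →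
      0 < (avail (gRun dg h0 tH wmin x y π j) z).card ∧
      ∑ a ∈ avail (gRun dg h0 tH wmin x y π j) z, Ψ (gReveal h0 (gRun dg h0 tH wmin x y π j) z a) ≤
        ((avail (gRun dg h0 tH wmin x y π j) z).card : ℝ) * Ψ (gRun dg h0 tH wmin x y π j)) :
    ∑ π ∈ PairingsF dg, Ψ (gRun dg h0 tH wmin x y π (j + 1)) ≤
      ∑ π ∈ PairingsF dg, Ψ (gRun dg h0 tH wmin x y π j) := by
  have hmaps : ∀ π ∈ PairingsF dg, gRun dg h0 tH wmin x y π j ∈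
      (PairingsF dg).image (fun π => gRun dg h0 tH wmin x y π j) :=
    fun π hπ => mem_image_of_mem _ hπ
  rw [← Finset.sum_fiberwise_of_maps_to hmaps, ← Finset.sum_fiberwise_of_maps_to hmaps]
  refine Finset.sum_le_sum fun s hs => ?_
  obtain ⟨π₀, hπ₀, rfl⟩ := mem_image.1 hs
  set s := gRun dg h0 tH wmin x y π₀ j with hs_def
  have hR : ∑ π ∈ PairingsF dg with gRun dg h0 tH wmin x y π j = s,
      Ψ (gRun dg h0 tH wmin x y π j) =
      (((PairingsF dg).filter (fun π => gRun dg h0 tH wmin x y π j = s)).card : ℝ) * Ψ s := by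
    rw [Finset.sum_congr rfl (g := fun _ => Ψ s), Finset.sum_const, nsmul_eq_mul]
    intro π hπ
    rw [(mem_filter.1 hπ).2]
  rw [hR]
  by_cases hz : ∃ z, IsSelected tH wmin s.base z
  · have hsel := Classical.choose_spec hz
    set z := Classical.choose hz with hz_def
    have hzc := hsel.1
    have hzp : z ∉ s.base.paired := by
      simp only [cands, mem_filter] at hzc
      exact hzc.2.1
    have hL : ∑ π ∈ PairingsF dg with gRun dg h0 tH wmin x y π j = s,
        Ψ (gRun dg h0 tH wmin x y π (j + 1)) =
        ∑ π ∈ PairingsF dg with gRun dg h0 tH wmin x y π j = s, Ψ (gReveal h0 s z (π z)) := by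
      refine Finset.sum_congr rfl fun π hπ => ?_
      rw [gRun_succ, (mem_filter.1 hπ).2, gStep, dif_pos hz]
    rw [hL]
    obtain ⟨hpos, hle⟩ := hΨ π₀ hπ₀ z hzc
    have hpos' : (0 : ℝ) < (avail s z).card := by exact_mod_cast hpos
    have key := sum_apply_of_gRun_eq (h0 := h0) (tH := tH) (wmin := wmin) (x := x) (y := y)
      j s z hzp (fun a => Ψ (gReveal h0 s z a))
    refine le_of_mul_le_mul_left ?_ hpos'
    rw [key]
    calc _ ≤ (((PairingsF dg).filter (fun π => gRun dg h0 tH wmin x y π j = s)).card : ℝ) *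
          (((avail s z).card : ℝ) * Ψ s) := by gcongr
      _ = _ := by ring
  · refine le_of_eq ?_
    rw [Finset.sum_congr rfl (g := fun _ => Ψ s), Finset.sum_const, nsmul_eq_mul]
    intro π hπ
    rw [gRun_succ, (mem_filter.1 hπ).2, gStep, dif_neg hz]

end Run

section Potential

variable {k : ℕ} {dg : Fin k → ℕ} {h0 tH : ℕ} {wmin : ℝ}

lemma card_neighbours_le (hmin : ∀ v, 3 ≤ dg v) (a : HE k dg) :
    ((univ.filter (fun w : HE k dg => w.1 = a.1 ∧ w ≠ a)).card : ℝ) ≤ (dg a.1 : ℝ) - 1 := by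
  have h1 : (univ.filter (fun w : HE k dg => w.1 = a.1 ∧ w ≠ a)) ⊆
      ((univ : Finset (Fin (dg a.1))).image (fun i => (⟨a.1, i⟩ : HE k dg))).erase a := by
    rintro ⟨v, i⟩ hw
    simp only [mem_filter, mem_univ, true_and] at hw
    obtain ⟨h, hne⟩ := hw
    subst h
    simp [hne]
  have ha : a ∈ (univ : Finset (Fin (dg a.1))).image (fun i => (⟨a.1, i⟩ : HE k dg)) :=
    mem_image.2 ⟨a.2, mem_univ _, rfl⟩
  have h2 := Finset.card_le_card h1
  rw [Finset.card_erase_of_mem ha] at h2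
  have h3 := (Finset.card_image_le (s := (univ : Finset (Fin (dg a.1))))
    (f := fun i => (⟨a.1, i⟩ : HE k dg)))
  rw [Finset.card_univ, Fintype.card_fin] at h3
  have h4 := hmin a.1
  have h5 : (univ.filter (fun w : HE k dg => w.1 = a.1 ∧ w ≠ a)).card + 1 ≤ dg a.1 := by omega
  have : (((univ.filter (fun w : HE k dg => w.1 = a.1 ∧ w ≠ a)).card + 1 : ℕ) : ℝ) ≤ dg a.1 := by
    exact_mod_cast h5
  push_cast at this
  linarith

/-- The auxiliary weight received by the children of `z` attached through `a`. -/
def childWh (h0 : ℕ) (s : GState k dg) (z a : HE k dg) : ℝ :=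
  if s.base.ht z < h0 then s.wh z else s.wh z * ((dg a.1 : ℝ) - 1)⁻¹

lemma gReveal_spec (hmin : ∀ v, 3 ≤ dg v) (s : GState k dg) (z a : HE k dg) :
    ∃ C : Finset (HE k dg), Disjoint C s.base.F ∧ (gReveal h0 s z a).base.F = s.base.F ∪ C ∧
      (∀ u ∈ s.base.F, (gReveal h0 s z a).base.ht u = s.base.ht u ∧
        (gReveal h0 s z a).base.wt u = s.base.wt u ∧
        (gReveal h0 s z a).base.rt u = s.base.rt u ∧ (gReveal h0 s z a).wh u = s.wh u) ∧
      (∀ c ∈ C, (gReveal h0 s z a).base.ht c = s.base.ht z + 1 ∧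
        (gReveal h0 s z a).base.wt c = s.base.wt z * ((dg a.1 : ℝ) - 1)⁻¹ ∧
        (gReveal h0 s z a).base.rt c = s.base.rt z ∧
        (gReveal h0 s z a).wh c = childWh h0 s z a) ∧
      (C.card : ℝ) ≤ (dg a.1 : ℝ) - 1 := by
  by_cases hf : ∀ y ∈ s.base.F, y.1 ≠ a.1
  · refine ⟨univ.filter (fun w => w.1 = a.1 ∧ w ≠ a), ?_, ?_, ?_, ?_, card_neighbours_le hmin a⟩
    · rw [Finset.disjoint_left]
      intro w hw hF
      exact hf w hF (mem_filter.1 hw).2.1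
    · simp only [gReveal, reveal, if_pos hf]
    · intro u hu
      have : ¬ (u.1 = a.1 ∧ u ≠ a) := fun h => hf u hu h.1
      have h2 : ¬ ((∀ y ∈ s.base.F, y.1 ≠ a.1) ∧ u.1 = a.1 ∧ u ≠ a) := fun h => this h.2
      simp only [gReveal, reveal, if_pos hf, if_neg this, if_neg h2, and_self]
    · intro c hc
      have hc := (mem_filter.1 hc).2
      have h2 : ((∀ y ∈ s.base.F, y.1 ≠ a.1) ∧ c.1 = a.1 ∧ c ≠ a) := ⟨hf, hc⟩
      simp only [gReveal, reveal, if_pos hf, if_pos hc, if_pos h2, childWh, and_self]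
  · refine ⟨∅, by simp, ?_, ?_, by simp, ?_⟩
    · simp only [gReveal, reveal, if_neg hf, union_empty]
    · intro u hu
      have h2 : ¬ ((∀ y ∈ s.base.F, y.1 ≠ a.1) ∧ u.1 = a.1 ∧ u ≠ a) := fun h => hf h.1
      simp only [gReveal, reveal, if_neg hf, if_neg h2, and_self]
    · have : (3 : ℝ) ≤ dg a.1 := by exact_mod_cast hmin a.1
      simp only [card_empty, Nat.cast_zero]
      linarith

lemma Uset_gReveal_subset {s : GState k dg} {z a : HE k dg} {C : Finset (HE k dg)}
    (hF : (gReveal h0 s z a).base.F = s.base.F ∪ C) :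
    Uset (gReveal h0 s z a).base ⊆ (Uset s.base).erase z ∪ C := by
  intro u hu
  simp only [Uset, mem_filter, hF, gReveal_paired, mem_union, mem_insert, not_or, mem_erase]
    at hu ⊢
  tauto

lemma Uset_subset (s : ExpState k dg) : Uset s ⊆ s.F := filter_subset _ _

/-- The total weight of the unexplored half-edges times their remaining height. -/
def budget (tH : ℕ) (s : ExpState k dg) : ℝ :=
  ∑ u ∈ Uset s, s.wt u * ((tH : ℝ) - s.ht u)

/-- Deterministic properties of the states visited by the exploration. -/
structure StateInv (tH : ℕ) (wmin : ℝ) (s : GState k dg) : Prop where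
  wt_pos : ∀ u ∈ s.base.F, 0 < s.base.wt u
  wt_le_wh : ∀ u ∈ s.base.F, s.base.wt u ≤ s.wh u
  wt_le_pow : ∀ u ∈ s.base.F, s.base.wt u ≤ (1 / 2) ^ s.base.ht u
  ht_le : ∀ u ∈ s.base.F, s.base.ht u ≤ tH
  mass : ∀ u ∈ s.base.F, ∑ v ∈ (Uset s.base).filter (fun v => s.base.rt v ≠ s.base.rt u),
    s.base.wt v ≤ 1
  paired_le : (s.base.paired.card : ℝ) * wmin / 2 + budget tH s.base ≤ 2 * tH

lemma inv_deg_mem (hmin : ∀ v, 3 ≤ dg v) (v : Fin k) :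
    0 < ((dg v : ℝ) - 1)⁻¹ ∧ ((dg v : ℝ) - 1)⁻¹ ≤ 1 / 2 := by
  have : (3 : ℝ) ≤ dg v := by exact_mod_cast hmin v
  refine ⟨by rw [inv_pos]; linarith, ?_⟩
  rw [one_div]
  exact inv_anti₀ (by norm_num) (by linarith)

lemma sum_children_le {a : HE k dg} (hmin : ∀ v, 3 ≤ dg v)
    {C : Finset (HE k dg)} (hC : (C.card : ℝ) ≤ (dg a.1 : ℝ) - 1) {c : ℝ} (hc : 0 ≤ c) :
    (C.card : ℝ) * (c * ((dg a.1 : ℝ) - 1)⁻¹) ≤ c := by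
  have h3 : (3 : ℝ) ≤ dg a.1 := by exact_mod_cast hmin a.1
  have hpos : 0 < (dg a.1 : ℝ) - 1 := by linarith
  calc (C.card : ℝ) * (c * ((dg a.1 : ℝ) - 1)⁻¹)
      ≤ ((dg a.1 : ℝ) - 1) * (c * ((dg a.1 : ℝ) - 1)⁻¹) := by
        gcongr
    _ = c := by field_simp

lemma budget_gReveal_le (hmin : ∀ v, 3 ≤ dg v) {s : GState k dg}
    (hs : StateInv tH wmin s) {z : HE k dg} (hz : z ∈ cands tH wmin s.base) (a : HE k dg) :
    budget tH (gReveal h0 s z a).base ≤ budget tH s.base - s.base.wt z := by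
  obtain ⟨C, hdisj, hF, hold, hnew, hcard⟩ := gReveal_spec (h0 := h0) hmin s z a
  have hsub := Uset_gReveal_subset hF
  set s' := gReveal h0 s z a with hs'
  simp only [cands, mem_filter] at hz
  obtain ⟨hzF, hzp, hzht, hzw⟩ := hz
  have hzU : z ∈ Uset s.base := mem_filter.2 ⟨hzF, hzp⟩
  obtain ⟨hd0, hd1⟩ := inv_deg_mem hmin a.1
  have hwz := hs.wt_pos z hzF
  have hcases : ∀ u ∈ s'.base.F, u ∈ s.base.F ∨ u ∈ C := by
    intro u hu; rw [hF] at hu; exact mem_union.1 hu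
  have hEF : (Uset s.base).erase z ⊆ s.base.F := (erase_subset _ _).trans (Uset_subset _)
  have hdE : Disjoint ((Uset s.base).erase z) C := (hdisj.mono_right hEF).symm
  have hsubF : (Uset s.base).erase z ∪ C ⊆ s'.base.F := by
    rw [hF]; exact union_subset_union hEF (Subset.refl _)
  have hpos' : ∀ u ∈ s'.base.F, 0 < s'.base.wt u := by
    intro u hu
    rcases hcases u hu with h | h
    · rw [(hold u h).2.1]; exact hs.wt_pos u h
    · rw [(hnew u h).2.1]; positivity
  have hht' : ∀ u ∈ s'.base.F, s'.base.ht u ≤ tH := by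
    intro u hu
    rcases hcases u hu with h | h
    · rw [(hold u h).1]; exact hs.ht_le u h
    · rw [(hnew u h).1]; exact hzht
  unfold budget
  have hzht' : (s.base.ht z : ℝ) + 1 ≤ tH := by exact_mod_cast hzht
  calc _ ≤ ∑ u ∈ (Uset s.base).erase z ∪ C, s'.base.wt u * ((tH : ℝ) - s'.base.ht u) := by
        refine Finset.sum_le_sum_of_subset_of_nonneg hsub fun v hv _ => ?_
        have h1 := (hpos' v (hsubF hv)).le
        have h2 : (s'.base.ht v : ℝ) ≤ tH := by exact_mod_cast hht' v (hsubF hv)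
        exact mul_nonneg h1 (by linarith)
    _ = ∑ u ∈ (Uset s.base).erase z, s.base.wt u * ((tH : ℝ) - s.base.ht u) +
        ∑ u ∈ C, (s.base.wt z * ((tH : ℝ) - (s.base.ht z + 1))) * ((dg a.1 : ℝ) - 1)⁻¹ := by
        rw [Finset.sum_union hdE]
        congr 1
        · refine Finset.sum_congr rfl fun v hv => ?_
          rw [(hold v (hEF hv)).1, (hold v (hEF hv)).2.1]
        · refine Finset.sum_congr rfl fun v hv => ?_
          rw [(hnew v hv).1, (hnew v hv).2.1]
          push_cast; ring
    _ ≤ ∑ u ∈ (Uset s.base).erase z, s.base.wt u * ((tH : ℝ) - s.base.ht u) +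
        s.base.wt z * ((tH : ℝ) - (s.base.ht z + 1)) := by
        gcongr
        rw [Finset.sum_const, nsmul_eq_mul]
        exact sum_children_le hmin hcard
          (mul_nonneg hwz.le (by linarith))
    _ = _ := by
        rw [← Finset.sum_erase_add _ _ hzU]; ring

lemma StateInv.gReveal_mem (hmin : ∀ v, 3 ≤ dg v) (hw : 0 ≤ wmin) {s : GState k dg}
    (hs : StateInv tH wmin s) {z : HE k dg} (hz : z ∈ cands tH wmin s.base) (a : HE k dg) :
    StateInv tH wmin (gReveal h0 s z a) := by
  obtain ⟨C, hdisj, hF, hold, hnew, hcard⟩ := gReveal_spec (h0 := h0) hmin s z a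
  have hsub := Uset_gReveal_subset hF
  have hp := gReveal_paired (h0 := h0) s z a
  set s' := gReveal h0 s z a with hs'
  simp only [cands, mem_filter] at hz
  obtain ⟨hzF, hzp, hzht, hzw⟩ := hz
  have hzU : z ∈ Uset s.base := mem_filter.2 ⟨hzF, hzp⟩
  obtain ⟨hd0, hd1⟩ := inv_deg_mem hmin a.1
  have hwz := hs.wt_pos z hzF
  have hcases : ∀ u ∈ s'.base.F, u ∈ s.base.F ∨ u ∈ C := by
    intro u hu; rw [hF] at hu; exact mem_union.1 hu
  have hEF : (Uset s.base).erase z ⊆ s.base.F := (erase_subset _ _).trans (Uset_subset _)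
  have hdE : Disjoint ((Uset s.base).erase z) C := (hdisj.mono_right hEF).symm
  have hpos' : ∀ u ∈ s'.base.F, 0 < s'.base.wt u := by
    intro u hu
    rcases hcases u hu with h | h
    · rw [(hold u h).2.1]; exact hs.wt_pos u h
    · rw [(hnew u h).2.1]; positivity
  have hht' : ∀ u ∈ s'.base.F, s'.base.ht u ≤ tH := by
    intro u hu
    rcases hcases u hu with h | h
    · rw [(hold u h).1]; exact hs.ht_le u h
    · rw [(hnew u h).1]; exact hzht
  have hsubF : (Uset s.base).erase z ∪ C ⊆ s'.base.F := by
    rw [hF]; exact union_subset_union hEF (Subset.refl _)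
  refine ⟨hpos', ?_, ?_, hht', ?_, ?_⟩
  · intro u hu
    rcases hcases u hu with h | h
    · rw [(hold u h).2.1, (hold u h).2.2.2]; exact hs.wt_le_wh u h
    · rw [(hnew u h).2.1, (hnew u h).2.2.2, childWh]
      have := hs.wt_le_wh z hzF
      split_ifs
      · nlinarith
      · gcongr
  · intro u hu
    rcases hcases u hu with h | h
    · rw [(hold u h).1, (hold u h).2.1]; exact hs.wt_le_pow u h
    · rw [(hnew u h).1, (hnew u h).2.1, pow_succ]
      have := hs.wt_le_pow z hzF
      gcongr
  · have gen : ∀ r ∈ s.base.F, ∑ v ∈ (Uset s'.base).filter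
        (fun v => s'.base.rt v ≠ s.base.rt r), s'.base.wt v ≤ 1 := by
      intro r hr
      refine le_trans ?_ (hs.mass r hr)
      rw [Finset.sum_filter, Finset.sum_filter]
      calc _ ≤ ∑ v ∈ (Uset s.base).erase z ∪ C,
            (if s'.base.rt v ≠ s.base.rt r then s'.base.wt v else 0) := by
            refine Finset.sum_le_sum_of_subset_of_nonneg hsub fun v hv _ => ?_
            split_ifs
            · exact (hpos' v (hsubF hv)).le
            · exact le_rfl
        _ = ∑ v ∈ (Uset s.base).erase z,
            (if s.base.rt v ≠ s.base.rt r then s.base.wt v else 0) +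
            ∑ v ∈ C, (if s.base.rt z ≠ s.base.rt r then
              s.base.wt z * ((dg a.1 : ℝ) - 1)⁻¹ else 0) := by
            rw [Finset.sum_union hdE]
            congr 1
            · refine Finset.sum_congr rfl fun v hv => ?_
              rw [(hold v (hEF hv)).2.1, (hold v (hEF hv)).2.2.1]
            · refine Finset.sum_congr rfl fun v hv => ?_
              rw [(hnew v hv).2.1, (hnew v hv).2.2.1]
        _ ≤ ∑ v ∈ (Uset s.base).erase z,
            (if s.base.rt v ≠ s.base.rt r then s.base.wt v else 0) +
            (if s.base.rt z ≠ s.base.rt r then s.base.wt z else 0) := by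
            gcongr
            rw [Finset.sum_const, nsmul_eq_mul]
            split_ifs
            · exact sum_children_le hmin hcard hwz.le
            · simp
        _ = _ := Finset.sum_erase_add _ _ hzU
    intro u hu
    rcases hcases u hu with h | h
    · rw [(hold u h).2.2.1]; exact gen u h
    · rw [(hnew u h).2.2.1]; exact gen z hzF
  · have hb := budget_gReveal_le (h0 := h0) hmin hs (mem_filter.2 ⟨hzF, hzp, hzht, hzw⟩) a
    rw [← hs'] at hb
    have hpc : (s'.base.paired.card : ℝ) ≤ s.base.paired.card + 2 := by
      rw [hp]
      have h1 := Finset.card_insert_le z (insert a s.base.paired)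
      have h2 := Finset.card_insert_le a s.base.paired
      exact_mod_cast (by omega : (insert z (insert a s.base.paired)).card ≤
        s.base.paired.card + 2)
    have := hs.paired_le
    nlinarith

/-- The probability that `w` multiplied by `j` independent weights `1 / (deg - 1)` of uniform
half-edges exceeds `θ`. -/
def tailF {k : ℕ} (dg : Fin k → ℕ) (θ : ℝ) : ℕ → ℝ → ℝ
  | 0, w => if θ < w then 1 else 0
  | j + 1, w => (Nh dg : ℝ)⁻¹ * ∑ a : HE k dg, tailF dg θ j (w * ((dg a.1 : ℝ) - 1)⁻¹)

lemma card_HE (dg : Fin k → ℕ) : (Finset.univ : Finset (HE k dg)).card = Nh dg := by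
  rw [Finset.card_univ, Fintype.card_sigma]
  simp [Nh]

lemma Nh_pos (z : HE k dg) : (0 : ℝ) < Nh dg := by
  rw [← card_HE]
  exact_mod_cast Finset.card_pos.2 ⟨z, mem_univ z⟩

lemma tailF_mem (θ : ℝ) (j : ℕ) (w : ℝ) : 0 ≤ tailF dg θ j w ∧ tailF dg θ j w ≤ 1 := by
  induction j generalizing w with
  | zero => unfold tailF; split_ifs <;> norm_num
  | succ j ih =>
    unfold tailF
    refine ⟨mul_nonneg (by positivity) (Finset.sum_nonneg fun a _ => (ih _).1), ?_⟩
    calc _ ≤ (Nh dg : ℝ)⁻¹ * ∑ _a : HE k dg, (1 : ℝ) := by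
          gcongr with a
          exact (ih _).2
      _ ≤ 1 := by
          rw [Finset.sum_const, card_HE, nsmul_eq_mul, mul_one]
          exact inv_mul_le_one

/-- The remaining number of recorded steps of a half-edge of height `h`. -/
def rem (tH h0 h : ℕ) : ℕ := tH - max h h0

/-- The contribution of two half-edges with different roots to the potential. -/
def pairK (h0 tH : ℕ) (θ : ℝ) (s : GState k dg) (u v : HE k dg) : ℝ :=
  if s.base.rt u ≠ s.base.rt v then
    s.base.wt u * s.base.wt v *
      tailF dg θ (rem tH h0 (s.base.ht u) + rem tH h0 (s.base.ht v)) (s.wh u * s.wh v)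
  else 0

/-- The potential of a state: the ideal conditional expectation of the final sum. -/
def potM (h0 tH : ℕ) (θ : ℝ) (s : GState k dg) : ℝ :=
  (1 / 2) * ∑ u ∈ Uset s.base, ∑ v ∈ Uset s.base, pairK h0 tH θ s u v

/-- The contribution of `z` to the potential. -/
def contrib (h0 tH : ℕ) (θ : ℝ) (s : GState k dg) (z : HE k dg) : ℝ :=
  ∑ v ∈ Uset s.base, pairK h0 tH θ s z v

/-- The contribution to the potential of the children of `z` attached through `a`. -/
def nextContrib (h0 tH : ℕ) (θ : ℝ) (s : GState k dg) (z a : HE k dg) : ℝ :=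
  ∑ v ∈ Uset s.base, if s.base.rt z ≠ s.base.rt v then
    s.base.wt z * s.base.wt v *
      tailF dg θ (rem tH h0 (s.base.ht z + 1) + rem tH h0 (s.base.ht v))
        (childWh h0 s z a * s.wh v)
  else 0

lemma pairK_comm (θ : ℝ) (s : GState k dg) (u v : HE k dg) :
    pairK h0 tH θ s u v = pairK h0 tH θ s v u := by
  unfold pairK
  rw [mul_comm (s.base.wt u), mul_comm (s.wh u), add_comm (rem tH h0 (s.base.ht u))]
  exact if_congr ne_comm rfl rfl

lemma pairK_self (θ : ℝ) (s : GState k dg) (u : HE k dg) : pairK h0 tH θ s u u = 0 := by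
  simp [pairK]

lemma pairK_nonneg {θ : ℝ} {s : GState k dg} (hs : StateInv tH wmin s) {u v : HE k dg}
    (hu : u ∈ s.base.F) (hv : v ∈ s.base.F) : 0 ≤ pairK h0 tH θ s u v := by
  unfold pairK
  split_ifs
  · exact mul_nonneg (mul_nonneg (hs.wt_pos u hu).le (hs.wt_pos v hv).le) (tailF_mem _ _ _).1
  · exact le_rfl

lemma sum_weighted_mem {s : GState k dg} (hs : StateInv tH wmin s) {z : HE k dg}
    (hz : z ∈ s.base.F) (g : HE k dg → ℝ) (hg : ∀ v, 0 ≤ g v ∧ g v ≤ 1) :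
    0 ≤ (∑ v ∈ Uset s.base, if s.base.rt z ≠ s.base.rt v then
      s.base.wt z * s.base.wt v * g v else 0) ∧
    (∑ v ∈ Uset s.base, if s.base.rt z ≠ s.base.rt v then
      s.base.wt z * s.base.wt v * g v else 0) ≤ s.base.wt z := by
  have hwz := (hs.wt_pos z hz).le
  constructor
  · refine Finset.sum_nonneg fun v hv => ?_
    have := (hs.wt_pos v (Uset_subset _ hv)).le
    split_ifs
    · exact mul_nonneg (mul_nonneg hwz this) (hg v).1
    · exact le_rfl
  · calc _ ≤ ∑ v ∈ Uset s.base, s.base.wt z *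
          (if s.base.rt v ≠ s.base.rt z then s.base.wt v else 0) := by
          refine Finset.sum_le_sum fun v hv => ?_
          have := (hs.wt_pos v (Uset_subset _ hv)).le
          rw [if_congr (ne_comm (a := s.base.rt z)) rfl rfl]
          split_ifs
          · exact mul_le_of_le_one_right (mul_nonneg hwz this) (hg v).2
          · simp
      _ ≤ s.base.wt z * 1 := by
          rw [← Finset.mul_sum, ← Finset.sum_filter]
          exact mul_le_mul_of_nonneg_left (hs.mass z hz) hwz
      _ = _ := mul_one _

lemma contrib_mem {θ : ℝ} {s : GState k dg} (hs : StateInv tH wmin s) {z : HE k dg}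
    (hz : z ∈ s.base.F) :
    0 ≤ contrib h0 tH θ s z ∧ contrib h0 tH θ s z ≤ s.base.wt z :=
  sum_weighted_mem hs hz _ fun _ => tailF_mem _ _ _

lemma nextContrib_mem {θ : ℝ} {s : GState k dg} (hs : StateInv tH wmin s) {z : HE k dg}
    (hz : z ∈ s.base.F) (a : HE k dg) :
    0 ≤ nextContrib h0 tH θ s z a ∧ nextContrib h0 tH θ s z a ≤ s.base.wt z :=
  sum_weighted_mem hs hz _ fun _ => tailF_mem _ _ _

lemma nextContrib_of_lt {θ : ℝ} {s : GState k dg} {z : HE k dg} (h : s.base.ht z < h0)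
    (a : HE k dg) : nextContrib h0 tH θ s z a = contrib h0 tH θ s z := by
  unfold nextContrib contrib pairK
  have h1 : rem tH h0 (s.base.ht z + 1) = rem tH h0 (s.base.ht z) := by
    unfold rem; omega
  rw [h1, childWh, if_pos h]

lemma sum_nextContrib {θ : ℝ} {s : GState k dg} {z : HE k dg} (h : h0 ≤ s.base.ht z)
    (hz : s.base.ht z < tH) :
    ∑ a : HE k dg, nextContrib h0 tH θ s z a = (Nh dg : ℝ) * contrib h0 tH θ s z := by
  have hN : (Nh dg : ℝ) ≠ 0 := (Nh_pos z).ne'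
  unfold nextContrib contrib pairK
  rw [Finset.sum_comm, Finset.mul_sum]
  refine Finset.sum_congr rfl fun v _ => ?_
  split_ifs
  · have h1 : rem tH h0 (s.base.ht z) + rem tH h0 (s.base.ht v) =
        (rem tH h0 (s.base.ht z + 1) + rem tH h0 (s.base.ht v)) + 1 := by
      unfold rem; omega
    have h2 : ∀ a : HE k dg, childWh h0 s z a * s.wh v =
        s.wh z * s.wh v * ((dg a.1 : ℝ) - 1)⁻¹ := by
      intro a
      rw [childWh, if_neg (by omega)]
      ring
    simp_rw [h1, tailF, h2]
    rw [← Finset.mul_sum]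
    field_simp
  · simp

lemma potM_gReveal_le (hmin : ∀ v, 3 ≤ dg v) (hw : 0 ≤ wmin) {θ : ℝ} {s : GState k dg}
    (hs : StateInv tH wmin s) {z : HE k dg} (hz : z ∈ cands tH wmin s.base) (a : HE k dg) :
    potM h0 tH θ (gReveal h0 s z a) ≤
      potM h0 tH θ s - contrib h0 tH θ s z + nextContrib h0 tH θ s z a := by
  have hs' := hs.gReveal_mem (h0 := h0) hmin hw hz a
  obtain ⟨C, hdisj, hF, hold, hnew, hcard⟩ := gReveal_spec (h0 := h0) hmin s z a
  have hsub := Uset_gReveal_subset hF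
  have hnc := nextContrib_mem (h0 := h0) (θ := θ) hs (mem_filter.1 hz).1 a
  unfold potM
  set s' := gReveal h0 s z a with hs'_def
  simp only [cands, mem_filter] at hz
  obtain ⟨hzF, hzp, hzht, hzw⟩ := hz
  have hzU : z ∈ Uset s.base := mem_filter.2 ⟨hzF, hzp⟩
  have hwz := hs.wt_pos z hzF
  obtain ⟨hd0, hd1⟩ := inv_deg_mem hmin a.1
  set E := (Uset s.base).erase z with hE
  have hEF : E ⊆ s.base.F := (erase_subset _ _).trans (Uset_subset _)
  have hdE : Disjoint E C := (hdisj.mono_right hEF).symm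
  have hsubF : E ∪ C ⊆ s'.base.F := by
    rw [hF]; exact union_subset_union hEF (Subset.refl _)
  have hEE : ∀ u ∈ E, ∀ v ∈ E, pairK h0 tH θ s' u v = pairK h0 tH θ s u v := by
    intro u hu v hv
    obtain ⟨a1, a2, a3, a4⟩ := hold u (hEF hu)
    obtain ⟨b1, b2, b3, b4⟩ := hold v (hEF hv)
    unfold pairK
    rw [a1, a2, a3, a4, b1, b2, b3, b4]
  have hCC : ∀ u ∈ C, ∀ v ∈ C, pairK h0 tH θ s' u v = 0 := by
    intro u hu v hv
    unfold pairK
    rw [(hnew u hu).2.2.1, (hnew v hv).2.2.1]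
    simp
  have hCE : ∑ c ∈ C, ∑ v ∈ E, pairK h0 tH θ s' c v ≤ nextContrib h0 tH θ s z a := by
    calc _ ≤ ∑ c ∈ C, nextContrib h0 tH θ s z a * ((dg a.1 : ℝ) - 1)⁻¹ := by
          refine Finset.sum_le_sum fun c hc => ?_
          rw [nextContrib, Finset.sum_mul]
          calc _ = ∑ v ∈ E, (if s.base.rt z ≠ s.base.rt v then
                  s.base.wt z * s.base.wt v *
                  tailF dg θ (rem tH h0 (s.base.ht z + 1) + rem tH h0 (s.base.ht v))
                    (childWh h0 s z a * s.wh v) else 0) * ((dg a.1 : ℝ) - 1)⁻¹ := by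
                refine Finset.sum_congr rfl fun v hv => ?_
                obtain ⟨a1, a2, a3, a4⟩ := hnew c hc
                obtain ⟨b1, b2, b3, b4⟩ := hold v (hEF hv)
                unfold pairK
                rw [a1, a2, a3, a4, b1, b2, b3, b4]
                split_ifs <;> ring
            _ ≤ _ := by
                refine Finset.sum_le_sum_of_subset_of_nonneg (erase_subset _ _) fun v hv _ => ?_
                refine mul_nonneg ?_ hd0.le
                have := (hs.wt_pos v (Uset_subset _ hv)).le
                split_ifs
                · exact mul_nonneg (mul_nonneg hwz.le this) (tailF_mem _ _ _).1
                · exact le_rfl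
      _ ≤ _ := by
          rw [Finset.sum_const, nsmul_eq_mul]
          exact sum_children_le hmin hcard hnc.1
  have hEC : ∑ u ∈ E, ∑ c ∈ C, pairK h0 tH θ s' u c = ∑ c ∈ C, ∑ v ∈ E, pairK h0 tH θ s' c v := by
    rw [Finset.sum_comm]
    exact Finset.sum_congr rfl fun _ _ => Finset.sum_congr rfl fun _ _ => pairK_comm _ _ _ _
  have h1 : ∑ u ∈ Uset s'.base, ∑ v ∈ Uset s'.base, pairK h0 tH θ s' u v ≤
      ∑ u ∈ E ∪ C, ∑ v ∈ E ∪ C, pairK h0 tH θ s' u v := by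
    calc _ ≤ ∑ u ∈ Uset s'.base, ∑ v ∈ E ∪ C, pairK h0 tH θ s' u v := by
          refine Finset.sum_le_sum fun u hu => ?_
          exact Finset.sum_le_sum_of_subset_of_nonneg hsub fun v hv _ =>
            pairK_nonneg hs' (Uset_subset _ hu) (hsubF hv)
      _ ≤ _ := Finset.sum_le_sum_of_subset_of_nonneg hsub fun u hu _ =>
          Finset.sum_nonneg fun v hv => pairK_nonneg hs' (hsubF hu) (hsubF hv)
  have h2 : ∑ u ∈ E ∪ C, ∑ v ∈ E ∪ C, pairK h0 tH θ s' u v =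
      ∑ u ∈ E, ∑ v ∈ E, pairK h0 tH θ s u v + 2 * ∑ c ∈ C, ∑ v ∈ E, pairK h0 tH θ s' c v := by
    simp_rw [Finset.sum_union hdE, Finset.sum_add_distrib]
    rw [hEC, Finset.sum_eq_zero (fun u hu => Finset.sum_eq_zero (hCC u hu)),
      Finset.sum_congr rfl (fun u hu => Finset.sum_congr rfl (hEE u hu))]
    ring
  have h3 : ∑ u ∈ Uset s.base, ∑ v ∈ Uset s.base, pairK h0 tH θ s u v =
      ∑ u ∈ E, ∑ v ∈ E, pairK h0 tH θ s u v + 2 * contrib h0 tH θ s z := by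
    have e : ∀ g : HE k dg → ℝ, ∑ u ∈ Uset s.base, g u = ∑ u ∈ E, g u + g z :=
      fun g => (Finset.sum_erase_add _ _ hzU).symm
    have e2 : ∑ u ∈ E, pairK h0 tH θ s u z = ∑ u ∈ E, pairK h0 tH θ s z u :=
      Finset.sum_congr rfl fun _ _ => pairK_comm _ _ _ _
    unfold contrib
    simp only [e, Finset.sum_add_distrib, pairK_self, e2]
    ring
  rw [h3]
  linarith

lemma avail_card {s : GState k dg} {z : HE k dg} (hz : z ∉ s.base.paired) :
    ((avail s z).card : ℝ) = Nh dg - s.base.paired.card - 1 := by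
  have h : avail s z = (insert z s.base.paired)ᶜ := by
    ext a
    simp only [avail, mem_filter, mem_univ, true_and, mem_compl, mem_insert, not_or]
    tauto
  have h2 := Finset.card_add_card_compl (insert z s.base.paired)
  rw [Finset.card_insert_of_notMem hz, ← Finset.card_univ, card_HE, ← h] at h2
  have : ((s.base.paired.card + 1 + (avail s z).card : ℕ) : ℝ) = Nh dg := by exact_mod_cast h2
  push_cast at this
  linarith

lemma exp_le_one_add_add_sq {y : ℝ} (hy : |y| ≤ 1) : Real.exp y ≤ 1 + y + y ^ 2 := by
  have := Real.abs_exp_sub_one_sub_id_le hy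
  have := (abs_le.1 this).2
  linarith

/-- The exponential potential, to be shown to be a supermartingale. -/
def expPot (h0 tH : ℕ) (θ S κ : ℝ) (s : GState k dg) : ℝ :=
  Real.exp (S * potM h0 tH θ s + κ * budget tH s.base)

lemma sum_expPot_gReveal_le (hmin : ∀ v, 3 ≤ dg v) (hw : 0 ≤ wmin) {θ S κ δ : ℝ}
    (hS : 0 ≤ S) (hδ : 0 ≤ δ) (hS1 : S * (1 / 2) ^ h0 ≤ 1)
    (hκ : S * δ + S ^ 2 * (1 / 2) ^ h0 ≤ κ) {s : GState k dg}
    (hs : StateInv tH wmin s) {z : HE k dg} (hz : z ∈ cands tH wmin s.base)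
    (hR : (Nh dg : ℝ) - (avail s z).card ≤ δ * (avail s z).card) :
    ∑ a ∈ avail s z, expPot h0 tH θ S κ (gReveal h0 s z a) ≤
      ((avail s z).card : ℝ) * expPot h0 tH θ S κ s := by
  have hzc := hz
  simp only [cands, mem_filter] at hz
  obtain ⟨hzF, hzp, hzht, hzw⟩ := hz
  have hwz := hs.wt_pos z hzF
  obtain ⟨hc0, hc1⟩ := contrib_mem (h0 := h0) (θ := θ) hs hzF
  set c := contrib h0 tH θ s z with hc
  set w := s.base.wt z with hw_def
  have hhalf : (0 : ℝ) < (1 / 2) ^ h0 := by positivity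
  have hκ0 : 0 ≤ κ := le_trans (by positivity) hκ
  have hstep : ∀ a, expPot h0 tH θ S κ (gReveal h0 s z a) ≤
      expPot h0 tH θ S κ s * Real.exp (-(κ * w)) *
        Real.exp (S * (nextContrib h0 tH θ s z a - c)) := by
    intro a
    unfold expPot
    rw [← Real.exp_add, ← Real.exp_add, Real.exp_le_exp]
    have h1 := mul_le_mul_of_nonneg_left
      (potM_gReveal_le (h0 := h0) (θ := θ) hmin hw hs hzc a) hS
    have h2 := mul_le_mul_of_nonneg_left
      (budget_gReveal_le (h0 := h0) hmin hs hzc a) hκ0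
    rw [← hc] at h1
    linarith
  have hsum : ∑ a ∈ avail s z, Real.exp (S * (nextContrib h0 tH θ s z a - c)) ≤
      ((avail s z).card : ℝ) * Real.exp (κ * w) := by
    have hcard : (0 : ℝ) ≤ (avail s z).card := by positivity
    by_cases hlt : s.base.ht z < h0
    · simp_rw [nextContrib_of_lt hlt]
      rw [← hc, sub_self, mul_zero, Real.exp_zero, Finset.sum_const, nsmul_eq_mul]
      refine mul_le_mul_of_nonneg_left ?_ hcard
      exact Real.one_le_exp (by positivity)
    · push Not at hlt
      have hwle : w ≤ (1 / 2) ^ h0 := (hs.wt_le_pow z hzF).trans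
        (pow_le_pow_of_le_one (by norm_num) (by norm_num) hlt)
      have hbound : ∀ a, Real.exp (S * (nextContrib h0 tH θ s z a - c)) ≤
          1 + S * (nextContrib h0 tH θ s z a - c) + S ^ 2 * w ^ 2 := by
        intro a
        obtain ⟨hn0, hn1⟩ := nextContrib_mem (h0 := h0) (θ := θ) hs hzF a
        have habs : |nextContrib h0 tH θ s z a - c| ≤ w := by
          rw [abs_le]; constructor <;> linarith
        have habs2 : |S * (nextContrib h0 tH θ s z a - c)| ≤ S * w := by
          rw [abs_mul, abs_of_nonneg hS]; gcongr
        have h1 : S * w ≤ 1 := le_trans (by gcongr) hS1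
        refine (exp_le_one_add_add_sq (habs2.trans h1)).trans ?_
        have := sq_le_sq' (by linarith [neg_abs_le (S * (nextContrib h0 tH θ s z a - c))])
          ((le_abs_self _).trans habs2)
        linarith [mul_pow S w 2]
      have hsumn : ∑ a ∈ avail s z, nextContrib h0 tH θ s z a ≤ (Nh dg : ℝ) * c := by
        rw [hc, ← sum_nextContrib hlt hzht]
        exact Finset.sum_le_sum_of_subset_of_nonneg (subset_univ _)
          fun a _ _ => (nextContrib_mem hs hzF a).1
      calc _ ≤ ∑ a ∈ avail s z, (1 + S * (nextContrib h0 tH θ s z a - c) + S ^ 2 * w ^ 2) :=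
            Finset.sum_le_sum fun a _ => hbound a
        _ = ((avail s z).card : ℝ) * (1 + S ^ 2 * w ^ 2) +
            S * (∑ a ∈ avail s z, nextContrib h0 tH θ s z a - (avail s z).card * c) := by
            simp only [Finset.sum_add_distrib, Finset.sum_const, nsmul_eq_mul, ← Finset.mul_sum,
              Finset.sum_sub_distrib]
            ring
        _ ≤ ((avail s z).card : ℝ) * (1 + S ^ 2 * w ^ 2) +
            S * (δ * (avail s z).card * w) := by
            gcongr
            calc _ ≤ (Nh dg : ℝ) * c - (avail s z).card * c := by linarith
              _ = ((Nh dg : ℝ) - (avail s z).card) * c := by ring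
              _ ≤ (δ * (avail s z).card) * c := by gcongr
              _ ≤ _ := by gcongr
        _ = ((avail s z).card : ℝ) * (1 + (S * δ + S ^ 2 * w) * w) := by ring
        _ ≤ ((avail s z).card : ℝ) * (1 + κ * w) := by
            gcongr
            refine le_trans ?_ hκ
            gcongr
        _ ≤ _ := by
            gcongr
            linarith [Real.add_one_le_exp (κ * w)]
  calc _ ≤ ∑ a ∈ avail s z, expPot h0 tH θ S κ s * Real.exp (-(κ * w)) *
        Real.exp (S * (nextContrib h0 tH θ s z a - c)) := Finset.sum_le_sum fun a _ => hstep a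
    _ ≤ expPot h0 tH θ S κ s * Real.exp (-(κ * w)) *
        (((avail s z).card : ℝ) * Real.exp (κ * w)) := by
        rw [← Finset.mul_sum]
        gcongr
        unfold expPot
        positivity
    _ = ((avail s z).card : ℝ) * expPot h0 tH θ S κ s *
        (Real.exp (-(κ * w)) * Real.exp (κ * w)) := by ring
    _ = _ := by rw [← Real.exp_add]; simp
end Potential

section Concentration

variable {k : ℕ} {dg : Fin k → ℕ} {h0 tH : ℕ} {wmin : ℝ} {x y : HE k dg}

lemma Uset_expInit (x y : HE k dg) : Uset (expInit dg x y) = {x, y} := by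
  simp [Uset, expInit]

lemma stateInv_init (hxy : x ≠ y) :
    StateInv tH wmin (⟨expInit dg x y, fun _ => 1⟩ : GState k dg) := by
  refine ⟨by simp [expInit], by simp [expInit], by simp [expInit], by simp [expInit], ?_, ?_⟩
  · intro u hu
    simp only [Uset_expInit]
    have hu' : u = x ∨ u = y := by simpa [expInit] using hu
    rw [Finset.sum_filter, Finset.sum_pair hxy]
    rcases hu' with rfl | rfl
    · simp [expInit]
      split_ifs <;> norm_num
    · simp [expInit, hxy]
  · rw [budget, Uset_expInit, Finset.sum_pair hxy]
    simp [expInit]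
    linarith

lemma stateInv_gRun (hmin : ∀ v, 3 ≤ dg v) (hw : 0 ≤ wmin) (hxy : x ≠ y)
    (π : Equiv.Perm (HE k dg)) (j : ℕ) :
    StateInv tH wmin (gRun dg h0 tH wmin x y π j) := by
  induction j with
  | zero => exact stateInv_init hxy
  | succ j ih =>
    rw [gRun_succ, gStep]
    split_ifs with hz
    · exact ih.gReveal_mem hmin hw (Classical.choose_spec hz).1 _
    · exact ih

lemma potM_init (hxy : x ≠ y) (θ : ℝ) :
    potM h0 tH θ (⟨expInit dg x y, fun _ => 1⟩ : GState k dg) =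
      tailF dg θ (2 * (tH - h0)) 1 := by
  simp only [potM, Uset_expInit, Finset.sum_pair hxy, pairK_self]
  rw [pairK_comm _ _ y x]
  have : tH - h0 + (tH - h0) = 2 * (tH - h0) := by ring
  simp [pairK, expInit, hxy, rem, this]
  ring

lemma budget_init (hxy : x ≠ y) : budget tH (expInit dg x y) = 2 * tH := by
  rw [budget, Uset_expInit, Finset.sum_pair hxy]
  simp [expInit]
  ring

lemma budget_nonneg {s : GState k dg} (hs : StateInv tH wmin s) : 0 ≤ budget tH s.base := by
  refine Finset.sum_nonneg fun u hu => ?_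
  have h2 : (s.base.ht u : ℝ) ≤ tH := by exact_mod_cast hs.ht_le u (Uset_subset _ hu)
  exact mul_nonneg (hs.wt_pos u (Uset_subset _ hu)).le (by linarith)

lemma Hset_eq (s : ExpState k dg) (r : HE k dg) :
    Hset s tH r = (Uset s).filter (fun u => s.ht u = tH ∧ s.rt u = r) := by
  rw [Hset, Uset, Finset.filter_filter]

lemma Wgt_le_potM (hxy : x ≠ y) {θ : ℝ} {s : GState k dg} (hs : StateInv tH wmin s) :
    Wgt s.base tH x y θ ≤ potM h0 tH θ s := by
  set g : HE k dg → HE k dg → ℝ := fun u v =>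
    if θ < s.base.wt u * s.base.wt v then s.base.wt u * s.base.wt v else 0 with hg
  set A : HE k dg → HE k dg → ℝ := fun u v =>
    if s.base.ht u = tH ∧ s.base.rt u = x then
      (if s.base.ht v = tH ∧ s.base.rt v = y then g u v else 0) else 0 with hA
  have hW : Wgt s.base tH x y θ = ∑ u ∈ Uset s.base, ∑ v ∈ Uset s.base, A u v := by
    rw [Wgt, Hset_eq, Hset_eq, Finset.sum_filter]
    refine Finset.sum_congr rfl fun u _ => ?_
    simp only [hA]
    split_ifs
    · rw [Finset.sum_filter]
    · simp
  have hW' : Wgt s.base tH x y θ = ∑ u ∈ Uset s.base, ∑ v ∈ Uset s.base, A v u := by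
    rw [hW, Finset.sum_comm]
  have hrem : rem tH h0 tH = 0 := by unfold rem; omega
  have hgK : ∀ u ∈ Uset s.base, ∀ v ∈ Uset s.base, s.base.ht u = tH → s.base.ht v = tH →
      s.base.rt u ≠ s.base.rt v → g u v ≤ pairK h0 tH θ s u v := by
    intro u hu v hv h1 h2 h3
    have hu' := Uset_subset _ hu
    have hv' := Uset_subset _ hv
    have hpu := hs.wt_pos u hu'
    have hpv := hs.wt_pos v hv'
    rw [pairK, if_pos h3, h1, h2, hrem, tailF]
    simp only [hg]
    have hle : s.base.wt u * s.base.wt v ≤ s.wh u * s.wh v :=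
      mul_le_mul (hs.wt_le_wh u hu') (hs.wt_le_wh v hv') hpv.le
        (hpu.le.trans (hs.wt_le_wh u hu'))
    split_ifs with h4 h5 h6
    · simp
    · exact absurd (h4.trans_le hle) h5
    · rw [mul_one]; positivity
    · simp
  have hterm : ∀ u ∈ Uset s.base, ∀ v ∈ Uset s.base, A u v + A v u ≤ pairK h0 tH θ s u v := by
    intro u hu v hv
    have hK := pairK_nonneg (h0 := h0) (θ := θ) hs (Uset_subset _ hu) (Uset_subset _ hv)
    by_cases h1 : (s.base.ht u = tH ∧ s.base.rt u = x) ∧ (s.base.ht v = tH ∧ s.base.rt v = y)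
    · have h2 : ¬ (s.base.ht v = tH ∧ s.base.rt v = x) := by
        rintro ⟨_, h⟩; exact hxy (h.symm.trans h1.2.2)
      simp only [hA]
      rw [if_pos h1.1, if_pos h1.2, if_neg h2, add_zero]
      exact hgK u hu v hv h1.1.1 h1.2.1 (by rw [h1.1.2, h1.2.2]; exact hxy)
    · have h1' : A u v = 0 := by
        simp only [hA]
        split_ifs with a b
        · exact absurd ⟨a, b⟩ h1
        · rfl
        · rfl
      rw [h1', zero_add]
      simp only [hA]
      split_ifs with a b
      · rw [pairK_comm]
        exact hgK v hv u hu a.1 b.1 (by rw [a.2, b.2]; exact hxy)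
      · exact hK
      · exact hK
  have h2 : Wgt s.base tH x y θ + Wgt s.base tH x y θ ≤
      ∑ u ∈ Uset s.base, ∑ v ∈ Uset s.base, pairK h0 tH θ s u v := by
    nth_rewrite 1 [hW]
    rw [hW', ← Finset.sum_add_distrib]
    refine Finset.sum_le_sum fun u hu => ?_
    rw [← Finset.sum_add_distrib]
    exact Finset.sum_le_sum fun v hv => hterm u hu v hv
  rw [potM]
  linarith

/-- A non-asymptotic concentration bound for the large-weight sum. -/
lemma prP_lt_Wgt_le (hmin : ∀ v, 3 ≤ dg v) (hw : 0 < wmin) (hxy : x ≠ y) {θ S κ δ : ℝ}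
    (hS : 0 ≤ S) (hδ : 0 ≤ δ) (hS1 : S * (1 / 2) ^ h0 ≤ 1)
    (hκ : S * δ + S ^ 2 * (1 / 2) ^ h0 ≤ κ)
    (hN : (1 + δ) * (4 * tH / wmin + 1) ≤ δ * Nh dg) (c : ℝ) :
    prP dg (fun π => c < Wgt (expFinal dg π tH wmin x y) tH x y θ) ≤
      Real.exp (S * (tailF dg θ (2 * (tH - h0)) 1 - c) + κ * (2 * tH)) := by
  have hκ0 : 0 ≤ κ := le_trans (by positivity) hκ
  have hmono : ∀ j, ∑ π ∈ PairingsF dg, expPot h0 tH θ S κ (gRun dg h0 tH wmin x y π j) ≤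
      ((PairingsF dg).card : ℝ) *
        Real.exp (S * tailF dg θ (2 * (tH - h0)) 1 + κ * (2 * tH)) := by
    intro j
    induction j with
    | zero =>
      refine le_of_eq ?_
      simp only [gRun, Function.iterate_zero, id, expPot, potM_init hxy, budget_init hxy,
        Finset.sum_const, nsmul_eq_mul]
    | succ j ih =>
      refine (sum_gRun_succ_le _ j fun π _ z hz => ?_).trans ih
      have hs := stateInv_gRun (h0 := h0) (tH := tH) hmin hw.le hxy π j
      set s := gRun dg h0 tH wmin x y π j
      have hzp : z ∉ s.base.paired := (mem_filter.1 hz).2.1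
      have hcard := avail_card hzp
      have hpaired : (s.base.paired.card : ℝ) ≤ 4 * tH / wmin := by
        rw [le_div_iff₀ hw]
        have := hs.paired_le
        have := budget_nonneg hs
        linarith
      have hQ : (0 : ℝ) ≤ 4 * tH / wmin := by positivity
      have hδN : (Nh dg : ℝ) - (avail s z).card ≤ δ * (avail s z).card := by
        rw [hcard]
        nlinarith
      refine ⟨?_, sum_expPot_gReveal_le hmin hw.le hS hδ hS1 hκ hs hz hδN⟩
      by_contra h0'
      have h0'' : (avail s z).card = 0 := by omega
      rw [h0''] at hδN
      have := Nh_pos z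
      simp at hδN
      rw [hδN] at this
      simp at this
  set Q : Equiv.Perm (HE k dg) → Prop :=
    fun π => c < Wgt (expFinal dg π tH wmin x y) tH x y θ with hQ
  have hmarkov : (((PairingsF dg).filter Q).card : ℝ) * Real.exp (S * c) ≤
      ∑ π ∈ PairingsF dg, expPot h0 tH θ S κ (gRun dg h0 tH wmin x y π (Nh dg)) := by
    rw [← nsmul_eq_mul, ← Finset.sum_const]
    calc _ ≤ ∑ π ∈ (PairingsF dg).filter Q,
          expPot h0 tH θ S κ (gRun dg h0 tH wmin x y π (Nh dg)) := by
          refine Finset.sum_le_sum fun π hπ => ?_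
          have hc := (mem_filter.1 hπ).2
          simp only [hQ] at hc
          have hs := stateInv_gRun (h0 := h0) (tH := tH) hmin hw.le hxy π (Nh dg)
          have h1 := Wgt_le_potM (h0 := h0) (θ := θ) hxy hs
          rw [gRun_base] at h1
          rw [expPot, Real.exp_le_exp]
          have h2 : c ≤ potM h0 tH θ (gRun dg h0 tH wmin x y π (Nh dg)) := hc.le.trans h1
          have h3 := budget_nonneg hs
          have h4 := mul_le_mul_of_nonneg_left h2 hS
          have h5 := mul_nonneg hκ0 h3
          linarith
      _ ≤ _ := Finset.sum_le_sum_of_subset_of_nonneg (filter_subset _ _)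
          fun π _ _ => (Real.exp_pos _).le
  have hfin := hmarkov.trans (hmono (Nh dg))
  rw [prP]
  rcases Nat.eq_zero_or_pos (PairingsF dg).card with h | h
  · rw [h]
    simp only [Nat.cast_zero, div_zero]
    exact (Real.exp_pos _).le
  · have hpos : (0 : ℝ) < (PairingsF dg).card := by exact_mod_cast h
    rw [div_le_iff₀ hpos]
    have : S * (tailF dg θ (2 * (tH - h0)) 1 - c) + κ * (2 * tH) =
      (S * tailF dg θ (2 * (tH - h0)) 1 + κ * (2 * tH)) - S * c := by ring
    rw [this, Real.exp_sub, div_mul_eq_mul_div, le_div_iff₀ (Real.exp_pos _)]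
    linarith

end Concentration

section NormalApproximation

open MeasureTheory ProbabilityTheory
open scoped ENNReal

variable {ι : Type*} [Fintype ι]

/-- The law of the sum of `i` independent copies of `c a`, with `a : ι` uniform. -/
def law (c : ι → ℝ) : ℕ → Measure ℝ
  | 0 => Measure.dirac 0
  | i + 1 => (Fintype.card ι : ℝ≥0∞)⁻¹ • ∑ a, (law c i).map (· + c a)

lemma isProbabilityMeasure_law [Nonempty ι] (c : ι → ℝ) (i : ℕ) :
    IsProbabilityMeasure (law c i) := by
  induction i with
  | zero => unfold law; infer_instance
  | succ i ih =>
    refine ⟨?_⟩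
    rw [law, Measure.smul_apply, Measure.finsetSum_apply]
    have : ∀ a, (law c i).map (· + c a) Set.univ = 1 := fun a => by
      rw [Measure.map_apply (by fun_prop) MeasurableSet.univ]
      simp
    simp only [this, Finset.sum_const, smul_eq_mul, Finset.card_univ, nsmul_eq_mul, mul_one]
    exact ENNReal.inv_mul_cancel (by simp) (by simp)

lemma law_real_succ [Nonempty ι] (c : ι → ℝ) (i : ℕ) (s : ℝ) :
    (law c (i + 1)).real (Set.Iio s) =
      (Fintype.card ι : ℝ)⁻¹ * ∑ a, (law c i).real (Set.Iio (s - c a)) := by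
  have := isProbabilityMeasure_law c i
  rw [law, Measure.real, Measure.smul_apply, Measure.finsetSum_apply, smul_eq_mul,
    ENNReal.toReal_mul, ENNReal.toReal_sum (fun a _ => by
      rw [Measure.map_apply (by fun_prop) measurableSet_Iio]; exact measure_ne_top _ _)]
  congr 1
  · simp
  · refine Finset.sum_congr rfl fun a _ => ?_
    rw [Measure.map_apply (by fun_prop) measurableSet_Iio, Measure.real]
    congr 2
    ext u
    simp [lt_sub_iff_add_lt]

/-- The characteristic function of `c a` for uniform `a : ι`. -/
def unifChar (c : ι → ℝ) (ξ : ℝ) : ℂ :=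
  (Fintype.card ι : ℂ)⁻¹ * ∑ a, Complex.exp (((ξ * c a : ℝ) : ℂ) * Complex.I)

lemma charFun_law [Nonempty ι] (c : ι → ℝ) (i : ℕ) (ξ : ℝ) :
    charFun (law c i) ξ = unifChar c ξ ^ i := by
  induction i with
  | zero => simp [law]
  | succ i ih =>
    have := isProbabilityMeasure_law c i
    have hp : ∀ a, IsProbabilityMeasure ((law c i).map (· + c a)) := fun a =>
      Measure.isProbabilityMeasure_map (by fun_prop)
    have hintegrable : ∀ a ∈ Finset.univ, Integrable (fun x : ℝ => Complex.exp (ξ * x * Complex.I))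
        ((law c i).map (· + c a)) := fun a _ => by
      refine Integrable.of_bound (C := 1) (by fun_prop) (Eventually.of_forall fun x => ?_)
      rw [← Complex.ofReal_mul, Complex.norm_exp_ofReal_mul_I]
    rw [charFun_apply_real, law, integral_smul_measure, integral_finsetSum_measure hintegrable]
    simp_rw [← charFun_apply_real, charFun_map_add_const, ih]
    rw [← Finset.mul_sum, unifChar, pow_succ]
    simp only [ENNReal.toReal_inv, ENNReal.toReal_natCast]
    rw [Complex.real_smul]
    push_cast
    simp only [RCLike.inner_apply, conj_trivial]
    push_cast
    ring

lemma norm_unifChar_le_one (c : ι → ℝ) (ξ : ℝ) : ‖unifChar c ξ‖ ≤ 1 := by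
  rw [unifChar, norm_mul, norm_inv]
  have h : ‖∑ a, Complex.exp (((ξ * c a : ℝ) : ℂ) * Complex.I)‖ ≤ Fintype.card ι := by
    refine (norm_sum_le _ _).trans ?_
    simp only [Complex.norm_exp_ofReal_mul_I]
    simp
  simp only [Complex.norm_natCast]
  calc _ ≤ (Fintype.card ι : ℝ)⁻¹ * Fintype.card ι := by gcongr
    _ ≤ 1 := inv_mul_le_one

lemma norm_exp_mul_I_sub_le (y : ℝ) :
    ‖Complex.exp (y * Complex.I) - (1 + y * Complex.I - y ^ 2 / 2)‖ ≤ 4 * |y| ^ 3 := by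
  rcases le_or_gt |y| 1 with h | h
  · have h1 := Complex.norm_exp_sub_sum_le_norm_mul_exp (y * Complex.I) 3
    simp only [norm_mul, Complex.norm_I, mul_one, Complex.norm_real, Real.norm_eq_abs] at h1
    have h2 : ∑ m ∈ Finset.range 3, (y * Complex.I) ^ m / (m.factorial : ℂ) =
        1 + y * Complex.I - y ^ 2 / 2 := by
      simp [Finset.sum_range_succ, mul_pow, Nat.factorial]
      ring
    rw [h2] at h1
    refine h1.trans ?_
    have h3 : Real.exp |y| ≤ 4 := by
      have := Real.exp_le_exp.2 h
      have := Real.exp_one_lt_d9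
      linarith
    have h4 : 0 ≤ |y| ^ 3 := by positivity
    nlinarith
  · have h1 : ‖Complex.exp (y * Complex.I) - (1 + y * Complex.I - y ^ 2 / 2)‖ ≤
        1 + (1 + |y| + |y| ^ 2 / 2) := by
      refine (norm_sub_le _ _).trans ?_
      rw [Complex.norm_exp_ofReal_mul_I]
      gcongr
      refine (norm_sub_le _ _).trans ?_
      gcongr
      · refine (norm_add_le _ _).trans ?_
        simp
      · simp
    refine h1.trans ?_
    have h2 : 1 ≤ |y| ^ 2 := by nlinarith
    have h3 : |y| ^ 2 ≤ |y| ^ 3 := by nlinarith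
    have h4 : |y| ≤ |y| ^ 2 := by nlinarith
    linarith

lemma norm_pow_sub_pow_le_mul {a b : ℂ} (ha : ‖a‖ ≤ 1) (hb : ‖b‖ ≤ 1) (j : ℕ) :
    ‖a ^ j - b ^ j‖ ≤ j * ‖a - b‖ := by
  induction j with
  | zero => simp
  | succ j ih =>
    have : a ^ (j + 1) - b ^ (j + 1) = a * (a ^ j - b ^ j) + (a - b) * b ^ j := by ring
    rw [this]
    refine (norm_add_le _ _).trans ?_
    rw [norm_mul, norm_mul, norm_pow]
    have h1 : ‖a‖ * ‖a ^ j - b ^ j‖ ≤ 1 * (j * ‖a - b‖) := by gcongr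
    have h2 : ‖a - b‖ * ‖b‖ ^ j ≤ ‖a - b‖ * 1 := by
      gcongr
      exact pow_le_one₀ (norm_nonneg _) hb
    push_cast
    linarith

lemma norm_unifChar_pow_sub_le [Nonempty ι] (c : ι → ℝ) {j : ℕ} (hj : 0 < j)
    (hm : ∑ a, c a = 0) (hv : (Fintype.card ι : ℝ)⁻¹ * ∑ a, c a ^ 2 = (j : ℝ)⁻¹) (ξ : ℝ)
    (hξ : ξ ^ 2 / 2 ≤ j) :
    ‖unifChar c ξ ^ j - Complex.exp (-(ξ : ℂ) ^ 2 / 2)‖ ≤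
      4 * |ξ| ^ 3 * (j * ((Fintype.card ι : ℝ)⁻¹ * ∑ a, |c a| ^ 3)) + ξ ^ 4 / 4 * (j : ℝ)⁻¹ := by
  have hj' : (0 : ℝ) < j := by exact_mod_cast hj
  have hjc : (j : ℂ) ≠ 0 := by exact_mod_cast hj.ne'
  set q : ℝ := ξ ^ 2 / 2 / j with hq
  have hq0 : 0 ≤ q := by positivity
  have hq1 : q ≤ 1 := by rw [hq, div_le_one hj']; exact hξ
  have hb : Complex.exp (-(ξ : ℂ) ^ 2 / 2) = ((Real.exp (-q) : ℝ) : ℂ) ^ j := by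
    rw [Complex.ofReal_exp, ← Complex.exp_nat_mul]
    congr 1
    rw [hq]
    push_cast
    field_simp
  have hcard : (Fintype.card ι : ℂ) ≠ 0 := by exact_mod_cast Fintype.card_ne_zero
  have hc0 : ∑ a, (c a : ℂ) = 0 := by exact_mod_cast hm
  have hc2 : (Fintype.card ι : ℂ)⁻¹ * ∑ a, (c a : ℂ) ^ 2 = (j : ℂ)⁻¹ := by
    have := congrArg (fun r : ℝ => (r : ℂ)) hv
    push_cast at this
    exact this
  have hdec : unifChar c ξ - ((1 - q : ℝ) : ℂ) = (Fintype.card ι : ℂ)⁻¹ *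
      ∑ a, (Complex.exp (((ξ * c a : ℝ) : ℂ) * Complex.I) -
        (1 + ((ξ * c a : ℝ) : ℂ) * Complex.I - ((ξ * c a : ℝ) : ℂ) ^ 2 / 2)) := by
    rw [Finset.sum_sub_distrib, mul_sub, unifChar, Finset.sum_sub_distrib, Finset.sum_add_distrib]
    push_cast
    congr 1
    rw [← Finset.sum_mul, ← Finset.mul_sum, hc0]
    simp_rw [mul_pow]
    rw [← Finset.sum_div, ← Finset.mul_sum]
    have : (Fintype.card ι : ℂ)⁻¹ * (∑ i : ι, (1 : ℂ) + ξ * 0 * Complex.I -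
        ξ ^ 2 * (∑ a, (c a : ℂ) ^ 2) / 2) =
        1 - ξ ^ 2 / 2 * ((Fintype.card ι : ℂ)⁻¹ * ∑ a, (c a : ℂ) ^ 2) := by
      rw [Finset.sum_const, Finset.card_univ, nsmul_eq_mul]
      field_simp
      ring
    rw [this, hc2, hq]
    push_cast
    field_simp
  have h1 : ‖unifChar c ξ - ((1 - q : ℝ) : ℂ)‖ ≤
      4 * |ξ| ^ 3 * ((Fintype.card ι : ℝ)⁻¹ * ∑ a, |c a| ^ 3) := by
    rw [hdec, norm_mul, norm_inv, Complex.norm_natCast]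
    calc _ ≤ (Fintype.card ι : ℝ)⁻¹ * ∑ a, 4 * (|ξ| ^ 3 * |c a| ^ 3) := by
          gcongr
          refine (norm_sum_le _ _).trans (Finset.sum_le_sum fun a _ => ?_)
          refine (norm_exp_mul_I_sub_le _).trans_eq ?_
          rw [abs_mul, mul_pow]
      _ = _ := by
          rw [← Finset.mul_sum, ← Finset.mul_sum]
          ring
  have h2 : ‖((1 - q : ℝ) : ℂ) - ((Real.exp (-q) : ℝ) : ℂ)‖ ≤ q ^ 2 := by
    rw [← Complex.ofReal_sub, Complex.norm_real, Real.norm_eq_abs, abs_sub_comm]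
    have := Real.abs_exp_sub_one_sub_id_le (x := -q) (by rw [abs_neg, abs_of_nonneg hq0]; exact hq1)
    rw [neg_sq] at this
    refine le_trans (le_of_eq ?_) this
    congr 1
    ring
  rw [hb]
  have h3 := norm_pow_sub_pow_le_mul (norm_unifChar_le_one c ξ)
    (b := ((Real.exp (-q) : ℝ) : ℂ)) (by
      rw [Complex.norm_real, Real.norm_eq_abs, abs_of_pos (Real.exp_pos _)]
      exact Real.exp_le_one_iff.2 (by linarith)) j
  have h4 := norm_sub_le_norm_sub_add_norm_sub (unifChar c ξ) ((1 - q : ℝ) : ℂ)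
    ((Real.exp (-q) : ℝ) : ℂ)
  calc _ ≤ _ := h3
    _ ≤ j * (4 * |ξ| ^ 3 * ((Fintype.card ι : ℝ)⁻¹ * ∑ a, |c a| ^ 3) + q ^ 2) := by
        gcongr
        linarith
    _ = _ := by
        rw [hq]
        field_simp
        ring

lemma gaussianReal_Iic_eq_Phi (s : ℝ) : (gaussianReal 0 1).real (Set.Iic s) = Phi (-s) := by
  have h : (gaussianReal 0 1).map (fun x => -x) = gaussianReal 0 1 := by
    rw [gaussianReal_map_neg]; simp
  have : NullSingletonClass (gaussianReal 0 1) := nullSingletonClass_gaussianReal one_ne_zero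
  rw [← h, measureReal_def, Measure.map_apply (by fun_prop) measurableSet_Iic]
  have : (fun x : ℝ => -x) ⁻¹' Set.Iic s = Set.Ici (-s) := by
    ext u; simp
  rw [this, measure_congr Ioi_ae_eq_Ici.symm, gaussianReal_apply_eq_integral _ (by norm_num),
    ENNReal.toReal_ofReal, Phi, ← integral_const_mul]
  · refine setIntegral_congr_fun measurableSet_Ioi fun u _ => ?_
    simp [gaussianPDFReal]
  · exact setIntegral_nonneg measurableSet_Ioi fun u _ => gaussianPDFReal_nonneg _ _ _

lemma Phi_sub_le (lam : ℝ) {δ : ℝ} (hδ : 0 ≤ δ) : Phi (lam - δ) ≤ Phi lam + δ := by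
  have hintegrable : Integrable (fun u : ℝ => Real.exp (-u ^ 2 / 2)) := by
    have := integrable_exp_neg_mul_sq (b := 1 / 2) (by norm_num)
    refine this.congr (Eventually.of_forall fun u => ?_)
    simp only
    congr 1
    ring
  have h1 : Set.Ioi (lam - δ) = Set.Ioc (lam - δ) lam ∪ Set.Ioi lam :=
    (Set.Ioc_union_Ioi_eq_Ioi (by linarith)).symm
  rw [Phi, Phi, h1, setIntegral_union (Set.Ioc_disjoint_Ioi le_rfl) measurableSet_Ioi
    hintegrable.integrableOn hintegrable.integrableOn, mul_add, add_comm]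
  gcongr
  have h2 : ∫ u in Set.Ioc (lam - δ) lam, Real.exp (-u ^ 2 / 2) ≤
      ∫ u in Set.Ioc (lam - δ) lam, (1 : ℝ) := by
    refine setIntegral_mono_on hintegrable.integrableOn (by simp) measurableSet_Ioc fun u _ => ?_
    exact Real.exp_le_one_iff.2 (by nlinarith [sq_nonneg u])
  have h3 : ∫ u in Set.Ioc (lam - δ) lam, (1 : ℝ) = δ := by
    simp [hδ]
  rw [h3] at h2
  have h4 : (Real.sqrt (2 * Real.pi))⁻¹ ≤ 1 := by
    apply inv_le_one_of_one_le₀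
    rw [Real.one_le_sqrt]
    nlinarith [Real.pi_gt_three]
  have h5 : 0 ≤ ∫ u in Set.Ioc (lam - δ) lam, Real.exp (-u ^ 2 / 2) :=
    setIntegral_nonneg measurableSet_Ioc fun u _ => (Real.exp_pos _).le
  calc _ ≤ 1 * δ := mul_le_mul h4 h2 h5 zero_le_one
    _ = δ := one_mul _

/-- A triangular-array central limit theorem for row-wise uniform finite families. -/
lemma tendsto_law_real_Iio {κ : ℕ → Type*} [∀ n, Fintype (κ n)] [∀ n, Nonempty (κ n)]
    (c : ∀ n, κ n → ℝ) (j : ℕ → ℕ) (hj : Tendsto j atTop atTop)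
    (hm : ∀ᶠ n in atTop, ∑ a, c n a = 0)
    (hv : ∀ᶠ n in atTop, (Fintype.card (κ n) : ℝ)⁻¹ * ∑ a, c n a ^ 2 = (j n : ℝ)⁻¹)
    (h3 : Tendsto (fun n => j n * ((Fintype.card (κ n) : ℝ)⁻¹ * ∑ a, |c n a| ^ 3))
      atTop (nhds 0))
    (b : ℕ → ℝ) (lam : ℝ) (hb : Tendsto b atTop (nhds (-lam))) {δ : ℝ} (hδ : 0 < δ) :
    ∀ᶠ n in atTop, (law (c n) (j n)).real (Set.Iio (b n)) ≤ Phi lam + δ := by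
  have hjr : Tendsto (fun n => (j n : ℝ)) atTop atTop := tendsto_natCast_atTop_atTop.comp hj
  have hp : ∀ n, IsProbabilityMeasure (law (c n) (j n)) := fun n => isProbabilityMeasure_law _ _
  let P : ℕ → ProbabilityMeasure ℝ := fun n => ⟨law (c n) (j n), hp n⟩
  let G : ProbabilityMeasure ℝ := ⟨gaussianReal 0 1, inferInstance⟩
  have : NullSingletonClass (gaussianReal 0 1) := nullSingletonClass_gaussianReal one_ne_zero
  have hPG : Tendsto P atTop (nhds G) := by
    refine ProbabilityMeasure.tendsto_iff_tendsto_charFun.2 fun ξ => ?_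
    have hG : charFun (G : Measure ℝ) ξ = Complex.exp (-(ξ : ℂ) ^ 2 / 2) := by
      change charFun (gaussianReal 0 1) ξ = _
      rw [charFun_gaussianReal]
      simp [neg_div]
    rw [hG, tendsto_iff_norm_sub_tendsto_zero]
    have hlim : Tendsto (fun n => 4 * |ξ| ^ 3 *
        (j n * ((Fintype.card (κ n) : ℝ)⁻¹ * ∑ a, |c n a| ^ 3)) + ξ ^ 4 / 4 * (j n : ℝ)⁻¹)
        atTop (nhds 0) := by
      simpa using (h3.const_mul (4 * |ξ| ^ 3)).add
        ((tendsto_inv_atTop_zero.comp hjr).const_mul (ξ ^ 4 / 4))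
    refine squeeze_zero' (Eventually.of_forall fun n => norm_nonneg _) ?_ hlim
    filter_upwards [hm, hv, hj.eventually_gt_atTop 0, hjr.eventually_ge_atTop (ξ ^ 2 / 2)]
      with n h1 h2 h3 h4
    change ‖charFun (law (c n) (j n)) ξ - _‖ ≤ _
    rw [charFun_law]
    exact norm_unifChar_pow_sub_le _ h3 h1 h2 ξ h4
  have hfr : (G : Measure ℝ) (frontier (Set.Iic (-lam + δ / 2))) = 0 := by
    change gaussianReal 0 1 _ = 0
    rw [frontier_Iic]
    exact measure_singleton _
  have hlim := ProbabilityMeasure.tendsto_measure_of_null_frontier_of_tendsto' hPG hfr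
  have hlim' : Tendsto (fun n => (law (c n) (j n)).real (Set.Iic (-lam + δ / 2))) atTop
      (nhds ((gaussianReal 0 1).real (Set.Iic (-lam + δ / 2)))) :=
    (ENNReal.tendsto_toReal (measure_ne_top _ _)).comp hlim
  rw [gaussianReal_Iic_eq_Phi] at hlim'
  have hPhi : Phi (-(-lam + δ / 2)) < Phi lam + δ := by
    have := Phi_sub_le lam (δ := δ / 2) (by linarith)
    rw [show -(-lam + δ / 2) = lam - δ / 2 by ring]
    linarith
  filter_upwards [hlim'.eventually_lt_const hPhi,
    hb.eventually_lt_const (show -lam < -lam + δ / 2 by linarith)] with n h1 h2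
  have hn := hp n
  refine le_trans (measureReal_mono fun u hu => ?_) h1.le
  simp only [Set.mem_Iio, Set.mem_Iic] at hu ⊢
  linarith

lemma tailF_eq_law {k : ℕ} {dg : Fin k → ℕ} [Nonempty (HE k dg)] (hmin : ∀ v, 3 ≤ dg v)
    {θ τ : ℝ} (hθ : 0 < θ) (hτ : 0 < τ) (m : ℝ) (i : ℕ) {w : ℝ} (hw : 0 < w) :
    tailF dg θ i w =
      (law (fun a : HE k dg => (Real.log ((dg a.1 : ℝ) - 1) - m) / τ) i).real
        (Set.Iio ((Real.log (w / θ) - i * m) / τ)) := by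
  induction i generalizing w with
  | zero =>
    have : (0 : ℝ) < (Real.log (w / θ) - (0 : ℕ) * m) / τ ↔ θ < w := by
      rw [div_pos_iff_of_pos_right hτ]
      simp only [Nat.cast_zero, zero_mul, sub_zero]
      rw [Real.log_pos_iff (by positivity), one_lt_div hθ]
    rw [tailF, law, measureReal_def, Measure.dirac_apply' _ measurableSet_Iio, Set.indicator_apply]
    simp only [Set.mem_Iio, this]
    split_ifs <;> simp
  | succ i ih =>
    rw [tailF, law_real_succ, ← card_HE, Finset.card_univ]
    congr 1
    refine Finset.sum_congr rfl fun a _ => ?_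
    have hd : (0 : ℝ) < (dg a.1 : ℝ) - 1 := by
      have : (3 : ℝ) ≤ dg a.1 := by exact_mod_cast hmin a.1
      linarith
    rw [ih (by positivity)]
    congr 2
    rw [mul_div_right_comm, Real.log_mul (by positivity) (by positivity), Real.log_inv]
    push_cast
    field_simp
    ring

end NormalApproximation

section Asymptotics

variable {k : ℕ} {dg : Fin k → ℕ}

lemma sum_HE (f : ℕ → ℝ) : ∑ a : HE k dg, f (dg a.1) = ∑ v, (dg v : ℝ) * f (dg v) := by
  rw [Fintype.sum_sigma]
  simp

lemma sum_log_sub_muD [Nonempty (HE k dg)] :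
    ∑ a : HE k dg, (Real.log ((dg a.1 : ℝ) - 1) - muD dg) = 0 := by
  have hN : (0 : ℝ) < Nh dg := Nh_pos (Classical.arbitrary (HE k dg))
  rw [Finset.sum_sub_distrib, Finset.sum_const, card_HE, nsmul_eq_mul,
    sum_HE fun d => Real.log ((d : ℝ) - 1), muD]
  field_simp
  ring

lemma card_inv_mul_sum_log_sq {τ : ℝ} :
    (Fintype.card (HE k dg) : ℝ)⁻¹ *
      ∑ a : HE k dg, ((Real.log ((dg a.1 : ℝ) - 1) - muD dg) / τ) ^ 2 = sigsq dg / τ ^ 2 := by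
  rw [sum_HE fun d => ((Real.log ((d : ℝ) - 1) - muD dg) / τ) ^ 2, sigsq, ← Finset.card_univ,
    card_HE, mul_div_assoc, Finset.sum_div]
  simp_rw [div_pow, mul_div_assoc]

lemma card_inv_mul_sum_abs_log_cube {τ : ℝ} (hτ : 0 < τ) :
    (Fintype.card (HE k dg) : ℝ)⁻¹ *
      ∑ a : HE k dg, |(Real.log ((dg a.1 : ℝ) - 1) - muD dg) / τ| ^ 3 = rhoD dg / τ ^ 3 := by
  rw [sum_HE fun d => |(Real.log ((d : ℝ) - 1) - muD dg) / τ| ^ 3, rhoD, ← Finset.card_univ,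
    card_HE, mul_div_assoc, Finset.sum_div]
  simp_rw [abs_div, abs_of_pos hτ, div_pow, mul_div_assoc]

lemma half_le_muD [Nonempty (HE k dg)] (hmin : ∀ v, 3 ≤ dg v) : 1 / 2 ≤ muD dg := by
  have hN : (0 : ℝ) < Nh dg := Nh_pos (Classical.arbitrary (HE k dg))
  have h1 : ∑ v, (dg v : ℝ) * (1 / 2) ≤ ∑ v, (dg v : ℝ) * Real.log ((dg v : ℝ) - 1) := by
    refine Finset.sum_le_sum fun v _ => ?_
    have hv : (3 : ℝ) ≤ dg v := by exact_mod_cast hmin v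
    have : Real.log 2 ≤ Real.log ((dg v : ℝ) - 1) := Real.log_le_log (by norm_num) (by linarith)
    have := Real.log_two_gt_d9
    gcongr
    linarith
  have h2 : ∑ v, (dg v : ℝ) * (1 / 2) = Nh dg * (1 / 2) := by
    rw [← Finset.sum_mul, Nh]
    push_cast
    rfl
  rw [h2] at h1
  rw [muD, ← div_eq_inv_mul, le_div_iff₀ hN]
  linarith

lemma sigsq_nonneg : 0 ≤ sigsq dg := by
  unfold sigsq
  positivity

lemma sigsq_le [Nonempty (HE k dg)] (hmin : ∀ v, 3 ≤ dg v) :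
    sigsq dg ≤ muD dg * Real.log (DeltaD dg) := by
  have hN : (0 : ℝ) < Nh dg := Nh_pos (Classical.arbitrary (HE k dg))
  have hsum : ∑ v, (dg v : ℝ) = Nh dg := by rw [Nh]; push_cast; rfl
  have hmu : ∑ v, (dg v : ℝ) * Real.log ((dg v : ℝ) - 1) = Nh dg * muD dg := by
    rw [muD]; field_simp
  have h1 : ∑ v, (dg v : ℝ) * (Real.log ((dg v : ℝ) - 1) - muD dg) ^ 2 =
      ∑ v, (dg v : ℝ) * Real.log ((dg v : ℝ) - 1) ^ 2 - Nh dg * muD dg ^ 2 := by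
    have : ∀ v, (dg v : ℝ) * (Real.log ((dg v : ℝ) - 1) - muD dg) ^ 2 =
        (dg v : ℝ) * Real.log ((dg v : ℝ) - 1) ^ 2 -
          2 * muD dg * ((dg v : ℝ) * Real.log ((dg v : ℝ) - 1)) + muD dg ^ 2 * dg v := fun v => by
      ring
    simp_rw [this]
    rw [Finset.sum_add_distrib, Finset.sum_sub_distrib, ← Finset.mul_sum, ← Finset.mul_sum, hmu,
      hsum]
    ring
  have h2 : ∑ v, (dg v : ℝ) * Real.log ((dg v : ℝ) - 1) ^ 2 ≤
      ∑ v, ((dg v : ℝ) * Real.log ((dg v : ℝ) - 1)) * Real.log (DeltaD dg) := by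
    refine Finset.sum_le_sum fun v _ => ?_
    have hv : (3 : ℝ) ≤ dg v := by exact_mod_cast hmin v
    have hle : (dg v : ℝ) ≤ DeltaD dg := by
      exact_mod_cast Finset.le_sup (f := dg) (Finset.mem_univ v)
    have h3 : Real.log ((dg v : ℝ) - 1) ≤ Real.log (DeltaD dg) :=
      Real.log_le_log (by linarith) (by linarith)
    have h4 : 0 ≤ Real.log ((dg v : ℝ) - 1) := Real.log_nonneg (by linarith)
    rw [pow_two, ← mul_assoc]
    gcongr
  rw [← Finset.sum_mul, hmu] at h2
  rw [sigsq, h1, ← div_eq_inv_mul, div_le_iff₀ hN]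
  nlinarith [mul_nonneg hN.le (sq_nonneg (muD dg))]

end Asymptotics

/-- Central limit bound for `tailF` in the normalisation given by `muD`, `sigsq` and `rhoD`. -/
lemma eventually_tailF_le {k : ℕ → ℕ} {dg : ∀ n, Fin (k n) → ℕ} (hmin : ∀ n v, 3 ≤ dg n v)
    (hne : ∀ n, Nonempty (HE (k n) (dg n)))
    (j : ℕ → ℕ) (hj : Tendsto j atTop atTop) (θ : ℕ → ℝ) (hθ : ∀ᶠ n in atTop, 0 < θ n)
    (hv : ∀ᶠ n in atTop, 0 < sigsq (dg n))
    (h3 : Tendsto (fun n => rhoD (dg n) / (√(sigsq (dg n)) ^ 3 * √(j n))) atTop (nhds 0))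
    (lam : ℝ)
    (hb : Tendsto (fun n => (Real.log (1 / θ n) - j n * muD (dg n)) / (√(sigsq (dg n)) * √(j n)))
      atTop (nhds (-lam))) {δ : ℝ} (hδ : 0 < δ) :
    ∀ᶠ n in atTop, tailF (dg n) (θ n) (j n) 1 ≤ Phi lam + δ := by
  have hpos : ∀ᶠ n in atTop, 0 < j n ∧ 0 < sigsq (dg n) :=
    (hj.eventually_gt_atTop 0).and hv
  have key := tendsto_law_real_Iio
    (c := fun n (a : HE (k n) (dg n)) =>
      (Real.log ((dg n a.1 : ℝ) - 1) - muD (dg n)) / (√(sigsq (dg n)) * √(j n))) j hj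
    (Eventually.of_forall fun n => by rw [← Finset.sum_div, sum_log_sub_muD, zero_div])
    (by
      filter_upwards [hpos] with n hn
      obtain ⟨h1, h2⟩ := hn
      have h1' : (0 : ℝ) < j n := by exact_mod_cast h1
      rw [card_inv_mul_sum_log_sq, mul_pow, Real.sq_sqrt h2.le, Real.sq_sqrt h1'.le]
      field_simp)
    (by
      refine h3.congr' ?_
      filter_upwards [hpos] with n hn
      obtain ⟨h1, h2⟩ := hn
      have h1' : (0 : ℝ) < j n := by exact_mod_cast h1
      have h4 := Real.sqrt_pos.2 h2
      have h5 := Real.sqrt_pos.2 h1'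
      rw [card_inv_mul_sum_abs_log_cube (mul_pos h4 h5)]
      nth_rewrite 2 [← Real.sq_sqrt h1'.le]
      field_simp) _ lam hb hδ
  filter_upwards [key, hpos, hθ] with n hn hp ht
  obtain ⟨h1, h2⟩ := hp
  have h1' : (0 : ℝ) < j n := by exact_mod_cast h1
  rw [tailF_eq_law (hmin n) ht (mul_pos (Real.sqrt_pos.2 h2) (Real.sqrt_pos.2 h1')) (muD (dg n))
    (j n) one_pos]
  exact hn

section WindowAsymptotics

variable {L M V R D : ℕ → ℝ}

lemma tendsto_window_div_log (hL : Tendsto L atTop atTop)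
    (h1 : Tendsto (fun n => V n / M n ^ 3 * L n / Real.log (L n) ^ 2) atTop atTop) :
    Tendsto (fun n => √(V n * L n / M n ^ 3) / Real.log (L n)) atTop atTop := by
  refine (Real.tendsto_sqrt_atTop.comp h1).congr' ?_
  filter_upwards [hL.eventually_gt_atTop 1] with n hn
  have hl : 0 < Real.log (L n) := Real.log_pos hn
  simp only [Function.comp]
  rw [Real.sqrt_div' _ (by positivity), Real.sqrt_sq hl.le]
  congr 2
  ring

lemma eventually_variance_pos (hM : ∀ n, 1 / 2 ≤ M n) (hL : Tendsto L atTop atTop)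
    (h1 : Tendsto (fun n => V n / M n ^ 3 * L n / Real.log (L n) ^ 2) atTop atTop) :
    ∀ᶠ n in atTop, 0 < V n := by
  filter_upwards [hL.eventually_gt_atTop 1, h1.eventually_gt_atTop 0] with n hn h
  by_contra hV
  have hM' : 0 < M n := by linarith [hM n]
  have : V n / M n ^ 3 * L n / Real.log (L n) ^ 2 ≤ 0 := by
    apply div_nonpos_of_nonpos_of_nonneg _ (sq_nonneg _)
    apply mul_nonpos_of_nonpos_of_nonneg _ (by linarith)
    exact div_nonpos_of_nonpos_of_nonneg (not_lt.1 hV) (by positivity)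
  linarith

lemma tendsto_window_atTop (hL : Tendsto L atTop atTop)
    (h1 : Tendsto (fun n => V n / M n ^ 3 * L n / Real.log (L n) ^ 2) atTop atTop) :
    Tendsto (fun n => √(V n * L n / M n ^ 3)) atTop atTop := by
  refine ((tendsto_window_div_log hL h1).atTop_mul_atTop₀
    (Real.tendsto_log_atTop.comp hL)).congr' ?_
  filter_upwards [hL.eventually_gt_atTop 1] with n hn
  have hl : 0 < Real.log (L n) := Real.log_pos hn
  simp only [Function.comp]
  field_simp

lemma tendsto_window_div_time (hM : ∀ n, 1 / 2 ≤ M n) (hL : Tendsto L atTop atTop)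
    (hVD : ∀ n, V n ≤ M n * D n)
    (hD : Tendsto (fun n => D n / L n) atTop (nhds 0)) :
    Tendsto (fun n => √(V n * L n / M n ^ 3) / (L n / M n)) atTop (nhds 0) := by
  have hs : Tendsto (fun n => √(D n / L n)) atTop (nhds 0) := by
    simpa [Function.comp_def] using (Real.continuous_sqrt.tendsto 0).comp hD
  refine squeeze_zero' ?_ ?_ hs
  · filter_upwards [hL.eventually_gt_atTop 1] with n hn
    have hM' : 0 < M n := by linarith [hM n]
    have : 0 < L n := by linarith
    positivity
  · filter_upwards [hL.eventually_gt_atTop 1] with n hn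
    have hM' : 0 < M n := by linarith [hM n]
    have hLn : 0 < L n := by linarith
    have hd : √(V n * L n / M n ^ 3) / (L n / M n) = √(V n * L n / M n ^ 3 / (L n / M n) ^ 2) := by
      rw [Real.sqrt_div' _ (sq_nonneg (L n / M n)), Real.sqrt_sq (by positivity)]
    rw [hd]
    apply Real.sqrt_le_sqrt
    have : V n * L n / M n ^ 3 / (L n / M n) ^ 2 = V n / M n / L n := by field_simp
    rw [this]
    gcongr
    rw [div_le_iff₀ hM']
    linarith [hVD n]

lemma tendsto_time_atTop (hM : ∀ n, 1 / 2 ≤ M n) (hL : Tendsto L atTop atTop)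
    (hVD : ∀ n, V n ≤ M n * D n)
    (hD : Tendsto (fun n => D n / L n) atTop (nhds 0))
    (h1 : Tendsto (fun n => V n / M n ^ 3 * L n / Real.log (L n) ^ 2) atTop atTop) :
    Tendsto (fun n => L n / M n) atTop atTop := by
  refine tendsto_atTop_mono' _ ?_ (tendsto_window_atTop hL h1)
  filter_upwards [hL.eventually_gt_atTop 1,
    (tendsto_window_div_time hM hL hVD hD).eventually_le_const (show (0 : ℝ) < 1 by norm_num)]
    with n hn h
  have hM' : 0 < M n := by linarith [hM n]
  have hLn : 0 < L n := by linarith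
  rwa [div_le_one (by positivity)] at h

variable {lam : ℝ} {s : ℕ → ℝ}

lemma tendsto_div_time (hM : ∀ n, 1 / 2 ≤ M n) (hL : Tendsto L atTop atTop)
    (hVD : ∀ n, V n ≤ M n * D n)
    (hD : Tendsto (fun n => D n / L n) atTop (nhds 0))
    (h1 : Tendsto (fun n => V n / M n ^ 3 * L n / Real.log (L n) ^ 2) atTop atTop)
    (hs : Tendsto (fun n => (s n - L n / M n - lam * √(V n * L n / M n ^ 3)) /
      √(V n * L n / M n ^ 3)) atTop (nhds 0)) :
    Tendsto (fun n => s n / (L n / M n)) atTop (nhds 1) := by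
  have := ((hs.add_const lam).mul (tendsto_window_div_time hM hL hVD hD)).add_const 1
  simp only [zero_add, mul_zero] at this
  refine this.congr' ?_
  filter_upwards [(tendsto_window_atTop hL h1).eventually_gt_atTop 0,
    hL.eventually_gt_atTop 1] with n hW hn
  have hM' : 0 < M n := by linarith [hM n]
  have hLn : 0 < L n := by linarith
  generalize √(V n * L n / M n ^ 3) = W at *
  field_simp
  ring

lemma tendsto_lyapunov (hM : ∀ n, 1 / 2 ≤ M n) (hL : Tendsto L atTop atTop)
    (h2 : Tendsto (fun n => √(V n) ^ 3 / (R n * √(M n)) * √(L n)) atTop atTop)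
    (hs : Tendsto (fun n => s n / (L n / M n)) atTop (nhds 1)) :
    Tendsto (fun n => R n / (√(V n) ^ 3 * √(s n))) atTop (nhds 0) := by
  have hs' : Tendsto (fun n => (√(s n / (L n / M n)))⁻¹) atTop (nhds 1) := by
    simpa using ((Real.continuous_sqrt.tendsto 1).comp hs).inv₀ (by simp)
  have := (tendsto_inv_atTop_zero.comp h2).mul hs'
  rw [zero_mul] at this
  refine this.congr' ?_
  filter_upwards [hL.eventually_gt_atTop 1] with n hn
  have hM' : 0 < M n := by linarith [hM n]
  have hLn : 0 < L n := by linarith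
  have h3 := Real.sqrt_pos.2 hM'
  have h4 := Real.sqrt_pos.2 hLn
  simp only [Function.comp]
  rw [Real.sqrt_div' _ (by positivity), Real.sqrt_div' _ hM'.le]
  simp only [mul_inv, div_eq_mul_inv, inv_inv]
  field_simp

lemma tendsto_normalised_threshold (hM : ∀ n, 1 / 2 ≤ M n) (hL : Tendsto L atTop atTop)
    (hV0 : ∀ n, 0 ≤ V n) (hVD : ∀ n, V n ≤ M n * D n)
    (hD : Tendsto (fun n => D n / L n) atTop (nhds 0))
    (h1 : Tendsto (fun n => V n / M n ^ 3 * L n / Real.log (L n) ^ 2) atTop atTop)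
    (hs : Tendsto (fun n => (s n - L n / M n - lam * √(V n * L n / M n ^ 3)) /
      √(V n * L n / M n ^ 3)) atTop (nhds 0)) :
    Tendsto (fun n => (L n + 2 * Real.log (L n) - s n * M n) / (√(V n) * √(s n)))
      atTop (nhds (-lam)) := by
  have hsT := tendsto_div_time hM hL hVD hD h1 hs
  have hT := tendsto_time_atTop hM hL hVD hD h1
  have hs' : Tendsto (fun n => (√(s n / (L n / M n)))⁻¹) atTop (nhds 1) := by
    simpa using ((Real.continuous_sqrt.tendsto 1).comp hsT).inv₀ (by simp)
  have hlog : Tendsto (fun n => 2 * Real.log (L n) / (√(V n * L n / M n ^ 3) * M n)) atTop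
      (nhds 0) := by
    have h := (tendsto_inv_atTop_zero.comp (tendsto_window_div_log hL h1)).const_mul 4
    rw [mul_zero] at h
    refine squeeze_zero' ?_ ?_ h
    · filter_upwards [hL.eventually_gt_atTop 1] with n hn
      have := Real.log_pos hn
      have := hM n
      positivity
    · filter_upwards [hL.eventually_gt_atTop 1,
        (tendsto_window_atTop hL h1).eventually_gt_atTop 0] with n hn hW
      have hl := Real.log_pos hn
      have hMn := hM n
      simp only [Function.comp, inv_div]
      rw [← mul_div_assoc, div_le_div_iff₀ (by positivity) hW]
      nlinarith [mul_pos hl hW]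
  have := ((hs.add_const lam).neg.add hlog).mul hs'
  simp only [zero_add, add_zero, mul_one] at this
  refine this.congr' ?_
  filter_upwards [(tendsto_window_atTop hL h1).eventually_gt_atTop 0,
    hL.eventually_gt_atTop 1, hsT.eventually_const_lt (show (0 : ℝ) < 1 by norm_num)]
    with n hW hn hsn
  have hM' : 0 < M n := by linarith [hM n]
  have hLn : 0 < L n := by linarith
  have hT' : 0 < L n / M n := by positivity
  have hs0 : 0 < s n := by
    by_contra h
    exact absurd hsn (not_lt.2 (div_nonpos_of_nonpos_of_nonneg (not_lt.1 h) hT'.le))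
  have hden : √(V n) * √(s n) = √(V n * L n / M n ^ 3) * M n * √(s n / (L n / M n)) := by
    rw [← Real.sqrt_mul (hV0 n), mul_right_comm, ← Real.sqrt_mul' _ hsn.le]
    nth_rewrite 3 [← Real.sqrt_sq hM'.le]
    rw [← Real.sqrt_mul' _ (by positivity)]
    congr 1
    field_simp
  rw [hden]
  have hq := Real.sqrt_pos.2 hsn
  generalize √(V n * L n / M n ^ 3) = W at *
  generalize √(s n / (L n / M n)) = q at *
  field_simp
  ring

end WindowAsymptotics

section Numerics

lemma eventually_numeric_bounds :
    ∀ᶠ L : ℝ in atTop, ∀ (h0 tH : ℕ), 12 * Real.log L ≤ h0 → (tH : ℝ) ≤ 2 * L →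
      L ^ 2 * (1 / 2) ^ h0 ≤ 1 ∧
      (L ^ 2 * (L ^ 4)⁻¹ + (L ^ 2) ^ 2 * (1 / 2) ^ h0) * (2 * tH) ≤ 8 ∧
      (1 + (L ^ 4)⁻¹) * (4 * tH / Real.exp (-(2 / 3) * L) + 1) ≤ (L ^ 4)⁻¹ * Real.exp L := by
  have h1 : Tendsto (fun L : ℝ => (L / 3) ^ 5 * Real.exp (-(L / 3))) atTop (nhds 0) :=
    (Real.tendsto_pow_mul_exp_neg_atTop_nhds_zero 5).comp
      (tendsto_id.atTop_div_const (by norm_num))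
  filter_upwards [eventually_ge_atTop 1,
    h1.eventually_le_const (show (0 : ℝ) < 1 / (18 * 3 ^ 5) by positivity)] with L hL hexp
  intro h0 tH hh ht
  have hL0 : 0 < L := by linarith
  have hlog : 0 ≤ Real.log L := Real.log_nonneg hL
  have hhalf : (1 / 2 : ℝ) ^ h0 ≤ (L ^ 8)⁻¹ := by
    have e1 : (1 / 2 : ℝ) ^ h0 = Real.exp (-(h0 * Real.log 2)) := by
      rw [Real.exp_neg, Real.exp_nat_mul, Real.exp_log (by norm_num), one_div, inv_pow]
    have e2 : (L ^ 8)⁻¹ = Real.exp (-(8 * Real.log L)) := by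
      rw [Real.exp_neg, show (8 : ℝ) * Real.log L = (8 : ℕ) * Real.log L by norm_num,
        Real.exp_nat_mul, Real.exp_log hL0]
    rw [e1, e2, Real.exp_le_exp]
    have := Real.log_two_gt_d9
    nlinarith
  refine ⟨?_, ?_, ?_⟩
  · calc L ^ 2 * (1 / 2) ^ h0 ≤ L ^ 2 * (L ^ 8)⁻¹ := by gcongr
      _ = (L ^ 6)⁻¹ := by field_simp
      _ ≤ 1 := inv_le_one_of_one_le₀ (one_le_pow₀ hL)
  · have : L ^ 2 * (L ^ 4)⁻¹ + (L ^ 2) ^ 2 * (1 / 2) ^ h0 ≤ 2 * L⁻¹ := by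
      calc L ^ 2 * (L ^ 4)⁻¹ + (L ^ 2) ^ 2 * (1 / 2) ^ h0
          ≤ L ^ 2 * (L ^ 4)⁻¹ + (L ^ 2) ^ 2 * (L ^ 8)⁻¹ := by gcongr
        _ = (L ^ 2)⁻¹ + (L ^ 4)⁻¹ := by field_simp
        _ ≤ L⁻¹ + L⁻¹ := by
            gcongr
            · exact le_self_pow₀ hL (by norm_num)
            · exact le_self_pow₀ hL (by norm_num)
        _ = _ := by ring
    calc _ ≤ (2 * L⁻¹) * (2 * (2 * L)) := by gcongr
      _ = 8 := by field_simp; norm_num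
  · have e1 : 4 * (tH : ℝ) / Real.exp (-(2 / 3) * L) = 4 * tH * Real.exp (2 / 3 * L) := by
      rw [neg_mul, Real.exp_neg, div_inv_eq_mul]
    have e2 : Real.exp L = Real.exp (2 / 3 * L) * Real.exp (L / 3) := by
      rw [← Real.exp_add]; congr 1; ring
    have e3 : 1 ≤ Real.exp (2 / 3 * L) := Real.one_le_exp (by positivity)
    have e4 : (L ^ 4)⁻¹ ≤ 1 := inv_le_one_of_one_le₀ (one_le_pow₀ hL)
    have e5 : 18 * L ^ 5 ≤ Real.exp (L / 3) := by
      rw [Real.exp_neg, ← div_eq_mul_inv, div_le_iff₀ (Real.exp_pos _)] at hexp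
      field_simp at hexp
      linarith
    rw [e1, e2]
    calc (1 + (L ^ 4)⁻¹) * (4 * tH * Real.exp (2 / 3 * L) + 1)
        ≤ (1 + 1) * (4 * (2 * L) * Real.exp (2 / 3 * L) + L * Real.exp (2 / 3 * L)) := by
          gcongr
          nlinarith
      _ = Real.exp (2 / 3 * L) * (18 * L) := by ring
      _ = (L ^ 4)⁻¹ * (Real.exp (2 / 3 * L) * (18 * L ^ 5)) := by field_simp
      _ ≤ _ := by gcongr

lemma tendsto_exp_neg_sq {ε : ℝ} (hε : 0 < ε) :
    Tendsto (fun L : ℝ => Real.exp (2 * L + (L ^ 2 * -ε + 8))) atTop (nhds 0) := by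
  refine Real.tendsto_exp_atBot.comp ?_
  have h1 : Tendsto (fun L : ℝ => -ε * L + 2) atTop atBot :=
    tendsto_atBot_add_const_right _ _ (tendsto_id.const_mul_atTop_of_neg (by linarith))
  have h2 := tendsto_atBot_add_const_right _ 8 (tendsto_id.atTop_mul_atBot₀ h1)
  refine h2.congr fun L => ?_
  simp only [id]
  ring

end Numerics

/-- For every `ε > 0`, the probability that `𝔚̄ > Φ(λ) + ε` is `o(1/N²)`, where `𝔚̄`
is the large-weight part of the pair-weight sum produced by the exposure process. -/
theorem large_weights_lemma
    (k : ℕ → ℕ) (dg : ∀ n, Fin (k n) → ℕ)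
    (hN : Tendsto (fun n => (Nh (dg n) : ℝ)) atTop atTop)
    (heven : ∀ n, Even (Nh (dg n)))
    (hmin : ∀ n v, 3 ≤ dg n v)
    (hΔ : Tendsto (fun n => Real.log (DeltaD (dg n)) / Real.log (Nh (dg n)))
      atTop (nhds 0))
    (h1 : Tendsto (fun n =>
        sigsq (dg n) / muD (dg n) ^ 3 * Real.log (Nh (dg n)) /
          Real.log (Real.log (Nh (dg n))) ^ 2) atTop atTop)
    (h2 : Tendsto (fun n =>
        Real.sqrt (sigsq (dg n)) ^ 3 / (rhoD (dg n) * Real.sqrt (muD (dg n))) *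
          Real.sqrt (Real.log (Nh (dg n)))) atTop atTop)
    (x y : ∀ n, HE (k n) (dg n)) (hxy : ∀ n, x n ≠ y n)
    (lam : ℝ) (t : ℕ → ℕ)
    (ht : Tendsto (fun n => ((t n : ℝ) - tstar (dg n) - lam * wstar (dg n)) / wstar (dg n))
      atTop (nhds 0))
    :
    ∀ ε > (0 : ℝ), Tendsto (fun n =>
      (Nh (dg n) : ℝ) ^ 2 * prP (dg n) (fun π =>
        Phi lam + ε <
          Wgt (expFinal (dg n) π (t n / 2) (wminD (dg n)) (x n) (y n))
            (t n / 2) (x n) (y n) (thetaD (dg n))))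
      atTop (nhds 0) := by
  intro ε hε
  have hne : ∀ n, Nonempty (HE (k n) (dg n)) := fun n => ⟨x n⟩
  have hNpos : ∀ n, (0 : ℝ) < Nh (dg n) := fun n => Nh_pos (x n)
  have hM : ∀ n, 1 / 2 ≤ muD (dg n) := fun n => half_le_muD (hmin n)
  have hV0 : ∀ n, 0 ≤ sigsq (dg n) := fun n => sigsq_nonneg
  have hVD : ∀ n, sigsq (dg n) ≤ muD (dg n) * Real.log (DeltaD (dg n)) := fun n =>
    sigsq_le (hmin n)
  have hL : Tendsto (fun n => Real.log (Nh (dg n))) atTop atTop := Real.tendsto_log_atTop.comp hN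
  have hLone := hL.eventually_gt_atTop 1
  have hW := tendsto_window_atTop hL h1
  have hlogW := tendsto_window_div_log hL h1
  have hT := tendsto_time_atTop hM hL hVD hΔ h1
  simp only [tstar, wstar] at ht
  set h0 : ℕ → ℕ := fun n => ⌈12 * Real.log (Real.log (Nh (dg n)))⌉₊ with hh0
  set j : ℕ → ℕ := fun n => 2 * (t n / 2 - h0 n) with hjdef
  have hjt : ∀ n, |(j n : ℝ) - t n| ≤ 1 + 2 * h0 n := fun n => by
    have e1 : t n ≤ j n + (1 + 2 * h0 n) := by simp only [hjdef]; omega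
    have e2 : j n ≤ t n := by simp only [hjdef]; omega
    have e1' : (t n : ℝ) ≤ j n + (1 + 2 * h0 n) := by exact_mod_cast e1
    have e2' : (j n : ℝ) ≤ t n := by exact_mod_cast e2
    rw [abs_le]
    constructor
    · linarith
    · have : (0 : ℝ) ≤ h0 n := by positivity
      linarith
  have hjs : Tendsto (fun n => ((j n : ℝ) - Real.log (Nh (dg n)) / muD (dg n) -
      lam * √(sigsq (dg n) * Real.log (Nh (dg n)) / muD (dg n) ^ 3)) /
      √(sigsq (dg n) * Real.log (Nh (dg n)) / muD (dg n) ^ 3)) atTop (nhds 0) := by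
    have hdiff : Tendsto (fun n => ((j n : ℝ) - t n) /
        √(sigsq (dg n) * Real.log (Nh (dg n)) / muD (dg n) ^ 3)) atTop (nhds 0) := by
      have hb : Tendsto (fun n => 3 * (√(sigsq (dg n) * Real.log (Nh (dg n)) / muD (dg n) ^ 3))⁻¹ +
          24 * (√(sigsq (dg n) * Real.log (Nh (dg n)) / muD (dg n) ^ 3) /
            Real.log (Real.log (Nh (dg n))))⁻¹) atTop (nhds 0) := by
        simpa using ((tendsto_inv_atTop_zero.comp hW).const_mul 3).add
          ((tendsto_inv_atTop_zero.comp hlogW).const_mul 24)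
      refine squeeze_zero_norm' ?_ hb
      filter_upwards [hLone, hW.eventually_gt_atTop 0] with n hn hWn
      have hl := Real.log_pos hn
      have hc : (h0 n : ℝ) ≤ 12 * Real.log (Real.log (Nh (dg n))) + 1 :=
        (Nat.ceil_lt_add_one (by positivity)).le
      rw [norm_div, Real.norm_eq_abs, Real.norm_of_nonneg hWn.le, div_le_iff₀ hWn]
      refine (hjt n).trans ?_
      generalize √(sigsq (dg n) * Real.log (Nh (dg n)) / muD (dg n) ^ 3) = W at *
      have : (3 * W⁻¹ + 24 * (W / Real.log (Real.log (Nh (dg n))))⁻¹) * W =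
          3 + 24 * Real.log (Real.log (Nh (dg n))) := by field_simp
      rw [this]
      linarith
    have := ht.add hdiff
    rw [add_zero] at this
    refine this.congr fun n => ?_
    rw [← add_div]
    congr 1
    ring
  have hjT := tendsto_div_time hM hL hVD hΔ h1 hjs
  have htT := tendsto_div_time hM hL hVD hΔ h1 ht
  have hj : Tendsto j atTop atTop := by
    rw [← tendsto_natCast_atTop_iff (R := ℝ)]
    refine (hjT.pos_mul_atTop one_pos hT).congr' ?_
    filter_upwards [hT.eventually_gt_atTop 0] with n hn
    exact div_mul_cancel₀ _ hn.ne'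
  have hθ : ∀ᶠ n in atTop, 0 < thetaD (dg n) := by
    filter_upwards [hLone] with n hn
    have := hNpos n
    have : 0 < Real.log (Nh (dg n)) := by linarith
    unfold thetaD
    positivity
  have hthr := tendsto_normalised_threshold hM hL hV0 hVD hΔ h1 hjs
  have htail := eventually_tailF_le hmin hne j hj (fun n => thetaD (dg n)) hθ
    (eventually_variance_pos hM hL h1) (tendsto_lyapunov hM hL h2 hjT) lam
    (by
      refine hthr.congr' ?_
      filter_upwards [hLone] with n hn
      have h3 := hNpos n
      have h4 : 0 < Real.log (Nh (dg n)) := by linarith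
      rw [thetaD, one_div, inv_inv, Real.log_mul h3.ne' (by positivity), Real.log_pow]
      norm_num) (half_pos hε)
  have hlim := (tendsto_exp_neg_sq (half_pos hε)).comp hL
  refine squeeze_zero' (Eventually.of_forall fun n => ?_) ?_ hlim
  · unfold prP
    positivity
  · filter_upwards [hLone, htail, hL.eventually eventually_numeric_bounds,
      htT.eventually_le_const (show (1 : ℝ) < 2 by norm_num), hT.eventually_gt_atTop 0]
      with n hn htl hnum htn hTn
    have hMn := hM n
    have hLn : 0 < Real.log (Nh (dg n)) := by linarith
    have htH : ((t n / 2 : ℕ) : ℝ) ≤ 2 * Real.log (Nh (dg n)) := by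
      have e1 : ((t n / 2 : ℕ) : ℝ) ≤ (t n : ℝ) / 2 := Nat.cast_div_le
      rw [div_le_iff₀ hTn] at htn
      have e2 : Real.log (Nh (dg n)) / muD (dg n) ≤ 2 * Real.log (Nh (dg n)) := by
        rw [div_le_iff₀ (by linarith)]
        nlinarith
      linarith
    obtain ⟨hS1, hκ, hNb⟩ := hnum (h0 n) (t n / 2) (Nat.le_ceil _) htH
    have hwmin : wminD (dg n) = Real.exp (-(2 / 3) * Real.log (Nh (dg n))) := by
      rw [wminD, Real.rpow_def_of_pos (hNpos n)]
      congr 1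
      ring
    have hmain := prP_lt_Wgt_le (h0 := h0 n) (tH := t n / 2) (wmin := wminD (dg n)) (θ := thetaD (dg n))
      (S := Real.log (Nh (dg n)) ^ 2) (δ := (Real.log (Nh (dg n)) ^ 4)⁻¹) (hmin n)
      (by rw [hwmin]; exact Real.exp_pos _) (hxy n) (by positivity)
      (by positivity) hS1 le_rfl
      (by rw [hwmin]; rwa [Real.exp_log (hNpos n)] at hNb) (Phi lam + ε)
    have hN2 : (Nh (dg n) : ℝ) ^ 2 = Real.exp (2 * Real.log (Nh (dg n))) := by
      rw [show (2 : ℝ) * Real.log (Nh (dg n)) = (2 : ℕ) * Real.log (Nh (dg n)) by norm_num,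
        Real.exp_nat_mul, Real.exp_log (hNpos n)]
    simp only [Function.comp]
    rw [Real.exp_add (2 * _), ← hN2]
    refine mul_le_mul_of_nonneg_left (hmain.trans (Real.exp_le_exp.2 ?_)) (by positivity)
    refine add_le_add ?_ hκ
    refine mul_le_mul_of_nonneg_left ?_ (by positivity)
    simp only [hjdef] at htl
    linarith


end
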